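/- Let N ≥ 5 be an integer, p > 1, and let s₀ be the unique root in (2t₀, ∞) of L(s) = s⁴ − (32p/(p+1))s² + (32p(p+3)/(p+1)²)s − 64p/(p+1)², where t₀ = √(2p/(p+1)) + √(2p/(p+1) − √(2p/(p+1))). Fix s with 2 ≤ s < s₀. Then there exists a constant C > 0 depending only on N, p, s such that for every classical stable solution u of Δ²u = u^p, u > 0 in ℝ^N, with v = −Δu, every R > 0 and every integer k ≥ 0: ∫_{B_{2^k R}} u^p v^{s−1} dx ≤ (C/R²) ∫_{B_{2^{k+1} R}} v^s dx. -/

import Mathlib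

open MeasureTheory Real

/-- The Laplacian of a function on `ℝ^N` (sum of pure second derivatives). -/
noncomputable def lap {N : ℕ} (u : EuclideanSpace ℝ (Fin N) → ℝ)
    (x : EuclideanSpace ℝ (Fin N)) : ℝ :=
  ∑ i : Fin N, fderiv ℝ (fun y => fderiv ℝ u y (EuclideanSpace.single i 1)) x
    (EuclideanSpace.single i 1)
/-- The quartic polynomial `L`. -/
noncomputable def Lpoly (p s : ℝ) : ℝ :=
  s ^ 4 - 32 * p / (p + 1) * s ^ 2 + 32 * p * (p + 3) / (p + 1) ^ 2 * s
    - 64 * p / (p + 1) ^ 2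

/-- `t₀ = √(2p/(p+1)) + √(2p/(p+1) − √(2p/(p+1)))`. -/
noncomputable def t0 (p : ℝ) : ℝ :=
  Real.sqrt (2 * p / (p + 1)) +
    Real.sqrt (2 * p / (p + 1) - Real.sqrt (2 * p / (p + 1)))

/-- The pointwise scalar product of the gradients of two functions on `ℝ^N`. -/
noncomputable def gradDot {N : ℕ} (f g : EuclideanSpace ℝ (Fin N) → ℝ)
    (x : EuclideanSpace ℝ (Fin N)) : ℝ :=
  ∑ i : Fin N, fderiv ℝ f x (EuclideanSpace.single i 1) *
    fderiv ℝ g x (EuclideanSpace.single i 1)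

section Calculus

variable {N : ℕ} {f g : EuclideanSpace ℝ (Fin N) → ℝ}

lemma contDiff_partial {m n : WithTop ℕ∞} (hf : ContDiff ℝ n f) (hmn : m + 1 ≤ n)
    (v : EuclideanSpace ℝ (Fin N)) : ContDiff ℝ m (fun y => fderiv ℝ f y v) :=
  (hf.fderiv_right hmn).clm_apply contDiff_const

lemma contDiff_lap {m n : WithTop ℕ∞} (hf : ContDiff ℝ n f) (hmn : m + 2 ≤ n) :
    ContDiff ℝ m (lap f) := by
  unfold lap
  refine ContDiff.sum fun i _ => ?_
  refine contDiff_partial (n := m + 1) ?_ le_rfl _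
  refine contDiff_partial hf ?_ _
  rwa [add_assoc, one_add_one_eq_two]

lemma ContDiff.continuous_lap (hf : ContDiff ℝ 2 f) : Continuous (lap f) :=
  (contDiff_lap (m := 0) hf (by simp)).continuous

lemma ContDiff.continuous_partial (hf : ContDiff ℝ 2 f) (v : EuclideanSpace ℝ (Fin N)) :
    Continuous (fun y => fderiv ℝ f y v) :=
  (contDiff_partial (m := 1) hf (by norm_num [one_add_one_eq_two]) v).continuous

lemma ContDiff.continuous_gradDot (hf : ContDiff ℝ 2 f) (hg : ContDiff ℝ 2 g) :
    Continuous (gradDot f g) := by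
  unfold gradDot
  exact continuous_finsetSum _ fun i _ =>
    (hf.continuous_partial _).mul (hg.continuous_partial _)

lemma ContDiff.differentiable_partial (hf : ContDiff ℝ 2 f) (v : EuclideanSpace ℝ (Fin N)) :
    Differentiable ℝ (fun y => fderiv ℝ f y v) :=
  (contDiff_partial (m := 1) hf (by norm_num [one_add_one_eq_two]) v).differentiable (by simp)

lemma gradDot_comm (f g : EuclideanSpace ℝ (Fin N) → ℝ) (x : EuclideanSpace ℝ (Fin N)) :
    gradDot f g x = gradDot g f x := by
  simp [gradDot, mul_comm]

lemma gradDot_self_nonneg (f : EuclideanSpace ℝ (Fin N) → ℝ) (x : EuclideanSpace ℝ (Fin N)) :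
    0 ≤ gradDot f f x :=
  Finset.sum_nonneg fun _ _ => mul_self_nonneg _

lemma gradDot_sq_le (f g : EuclideanSpace ℝ (Fin N) → ℝ) (x : EuclideanSpace ℝ (Fin N)) :
    gradDot f g x ^ 2 ≤ gradDot f f x * gradDot g g x := by
  have := Finset.sum_mul_sq_le_sq_mul_sq Finset.univ
    (fun i : Fin N => fderiv ℝ f x (EuclideanSpace.single i 1))
    (fun i => fderiv ℝ g x (EuclideanSpace.single i 1))
  simpa [gradDot, sq] using this

lemma lap_mul (hf : ContDiff ℝ 2 f) (hg : ContDiff ℝ 2 g) (x : EuclideanSpace ℝ (Fin N)) :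
    lap (fun y => f y * g y) x = f x * lap g x + 2 * gradDot f g x + g x * lap f x := by
  have hfd : Differentiable ℝ f := hf.differentiable (by simp)
  have hgd : Differentiable ℝ g := hg.differentiable (by simp)
  unfold lap gradDot
  rw [Finset.mul_sum, Finset.mul_sum, Finset.mul_sum, ← Finset.sum_add_distrib,
    ← Finset.sum_add_distrib]
  refine Finset.sum_congr rfl fun i _ => ?_
  have h1 : (fun y => fderiv ℝ (fun y => f y * g y) y (EuclideanSpace.single i (1:ℝ))) =
      fun y => f y * fderiv ℝ g y (EuclideanSpace.single i 1) +
        g y * fderiv ℝ f y (EuclideanSpace.single i 1) := by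
    ext y
    rw [fderiv_fun_mul (hfd y) (hgd y)]
    simp
  rw [h1, fderiv_fun_add ((hfd x).fun_mul (hg.differentiable_partial _ x))
    ((hgd x).fun_mul (hf.differentiable_partial _ x)),
    fderiv_fun_mul (hfd x) (hg.differentiable_partial _ x),
    fderiv_fun_mul (hgd x) (hf.differentiable_partial _ x)]
  simp
  ring

lemma gradDot_mul (hf : ContDiff ℝ 2 f) (hg : ContDiff ℝ 2 g)
    (h : EuclideanSpace ℝ (Fin N) → ℝ) (x : EuclideanSpace ℝ (Fin N)) :
    gradDot (fun y => f y * g y) h x = f x * gradDot g h x + g x * gradDot f h x := by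
  have hfd : Differentiable ℝ f := hf.differentiable (by simp)
  have hgd : Differentiable ℝ g := hg.differentiable (by simp)
  unfold gradDot
  rw [Finset.mul_sum, Finset.mul_sum, ← Finset.sum_add_distrib]
  refine Finset.sum_congr rfl fun i _ => ?_
  rw [fderiv_fun_mul (hfd x) (hgd x)]
  simp
  ring

lemma gradDot_comp {φ φ' : ℝ → ℝ} (hf : ContDiff ℝ 2 f) (x : EuclideanSpace ℝ (Fin N))
    (hφ : HasDerivAt φ (φ' (f x)) (f x)) (h : EuclideanSpace ℝ (Fin N) → ℝ) :
    gradDot (fun y => φ (f y)) h x = φ' (f x) * gradDot f h x := by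
  have hfd : Differentiable ℝ f := hf.differentiable (by simp)
  unfold gradDot
  rw [Finset.mul_sum]
  refine Finset.sum_congr rfl fun i _ => ?_
  have := (hφ.comp_hasFDerivAt x (hfd x).hasFDerivAt).fderiv
  rw [show (fun y => φ (f y)) = φ ∘ f from rfl, this]
  simp
  ring

lemma lap_comp {φ φ' φ'' : ℝ → ℝ} (hf : ContDiff ℝ 2 f)
    (hφ : ∀ x, HasDerivAt φ (φ' (f x)) (f x)) (hφ' : ∀ x, HasDerivAt φ' (φ'' (f x)) (f x))
    (x : EuclideanSpace ℝ (Fin N)) :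
    lap (fun y => φ (f y)) x = φ' (f x) * lap f x + φ'' (f x) * gradDot f f x := by
  have hfd : Differentiable ℝ f := hf.differentiable (by simp)
  unfold lap gradDot
  rw [Finset.mul_sum, Finset.mul_sum, ← Finset.sum_add_distrib]
  refine Finset.sum_congr rfl fun i _ => ?_
  have h1 : (fun y => fderiv ℝ (fun y => φ (f y)) y (EuclideanSpace.single i (1:ℝ))) =
      fun y => φ' (f y) * fderiv ℝ f y (EuclideanSpace.single i 1) := by
    ext y
    have := ((hφ y).comp_hasFDerivAt y (hfd y).hasFDerivAt).fderiv
    rw [show (fun y => φ (f y)) = φ ∘ f from rfl, this]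
    simp
  have h2 := (hφ' x).comp_hasFDerivAt x (hfd x).hasFDerivAt
  have h3 := (h2.mul (hf.differentiable_partial (EuclideanSpace.single i 1) x).hasFDerivAt).fderiv
  rw [h1]
  rw [show (fun y => φ' (f y) * fderiv ℝ f y (EuclideanSpace.single i 1)) =
    (φ' ∘ f) * (fun y => fderiv ℝ f y (EuclideanSpace.single i 1)) from rfl, h3]
  simp
  ring

lemma lap_add (hf : ContDiff ℝ 2 f) (hg : ContDiff ℝ 2 g) (x : EuclideanSpace ℝ (Fin N)) :
    lap (fun y => f y + g y) x = lap f x + lap g x := by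
  have hfd : Differentiable ℝ f := hf.differentiable (by simp)
  have hgd : Differentiable ℝ g := hg.differentiable (by simp)
  unfold lap
  rw [← Finset.sum_add_distrib]
  refine Finset.sum_congr rfl fun i _ => ?_
  have h1 : (fun y => fderiv ℝ (fun y => f y + g y) y (EuclideanSpace.single i (1:ℝ))) =
      fun y => fderiv ℝ f y (EuclideanSpace.single i 1) +
        fderiv ℝ g y (EuclideanSpace.single i 1) := by
    ext y
    rw [fderiv_fun_add (hfd y) (hgd y)]
    simp
  rw [h1, fderiv_fun_add (hf.differentiable_partial _ x) (hg.differentiable_partial _ x)]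
  simp

lemma lap_const_mul (c : ℝ) (hf : ContDiff ℝ 2 f) (x : EuclideanSpace ℝ (Fin N)) :
    lap (fun y => c * f y) x = c * lap f x := by
  have := lap_comp (φ := fun t => c * t) (φ' := fun _ => c) (φ'' := fun _ => 0) hf
    (fun x => by simpa using (hasDerivAt_id (f x)).const_mul c)
    (fun x => hasDerivAt_const _ _) x
  simpa using this

lemma lap_neg (hf : ContDiff ℝ 2 f) (x : EuclideanSpace ℝ (Fin N)) :
    lap (fun y => -f y) x = -lap f x := by
  simpa using lap_const_mul (-1) hf x

lemma partial_eq_zero {v x : EuclideanSpace ℝ (Fin N)} (hx : x ∉ tsupport f) :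
    fderiv ℝ f x v = 0 := by
  rw [image_eq_zero_of_notMem_tsupport (fun h => hx (tsupport_fderiv_subset ℝ h))]
  rfl

lemma lap_eq_zero {x : EuclideanSpace ℝ (Fin N)} (hx : x ∉ tsupport f) : lap f x = 0 := by
  unfold lap
  refine Finset.sum_eq_zero fun i _ => ?_
  refine partial_eq_zero fun h => hx (closure_minimal ?_ (isClosed_tsupport f) h)
  intro y hy
  by_contra h'
  exact hy (partial_eq_zero h')

lemma gradDot_eq_zero {x : EuclideanSpace ℝ (Fin N)} (hx : x ∉ tsupport g) :
    gradDot f g x = 0 := by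
  unfold gradDot
  exact Finset.sum_eq_zero fun i _ => by rw [partial_eq_zero hx, mul_zero]

lemma HasCompactSupport.lap (hf : HasCompactSupport f) : HasCompactSupport (lap f) :=
  HasCompactSupport.intro hf fun _ hx => lap_eq_zero hx

lemma HasCompactSupport.gradDot (hg : HasCompactSupport g) : HasCompactSupport (gradDot f g) :=
  HasCompactSupport.intro hg fun _ hx => gradDot_eq_zero hx

lemma HasCompactSupport.fderiv_apply_const (hf : HasCompactSupport f)
    (v : EuclideanSpace ℝ (Fin N)) :
    HasCompactSupport (fun y => fderiv ℝ f y v) :=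
  HasCompactSupport.intro hf fun _ hx => partial_eq_zero hx

/-- Integration by parts: first Green identity. -/
lemma integral_mul_lap_eq_neg_gradDot (hf : ContDiff ℝ 2 f) (hg : ContDiff ℝ 2 g)
    (hgc : HasCompactSupport g) :
    ∫ x, f x * lap g x = - ∫ x, gradDot f g x := by
  unfold lap gradDot
  simp_rw [Finset.mul_sum]
  have hfd : Differentiable ℝ f := hf.differentiable (by simp)
  have i1 : ∀ i : Fin N, Integrable fun x => f x *
      fderiv ℝ (fun y => fderiv ℝ g y (EuclideanSpace.single i 1)) x
        (EuclideanSpace.single i 1) := fun i =>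
    (hf.continuous.mul (contDiff_partial (m := 0) (n := 1)
      (contDiff_partial (m := 1) hg (by norm_num [one_add_one_eq_two]) _) (by simp)
        _).continuous).integrable_of_hasCompactSupport
      ((hgc.fderiv_apply_const _).fderiv_apply_const _).mul_left
  have i2 : ∀ i : Fin N, Integrable fun x => fderiv ℝ f x (EuclideanSpace.single i 1) *
      fderiv ℝ g x (EuclideanSpace.single i 1) := fun i =>
    ((hf.continuous_partial _).mul (hg.continuous_partial _)).integrable_of_hasCompactSupport
      (hgc.fderiv_apply_const _).mul_left
  have i3 : ∀ i : Fin N, Integrable fun x => f x *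
      fderiv ℝ g x (EuclideanSpace.single i 1) := fun i =>
    (hf.continuous.mul (hg.continuous_partial _)).integrable_of_hasCompactSupport
      (hgc.fderiv_apply_const _).mul_left
  rw [integral_finsetSum _ fun i _ => i1 i, integral_finsetSum _ fun i _ => i2 i,
    ← Finset.sum_neg_distrib]
  exact Finset.sum_congr rfl fun i _ => integral_mul_fderiv_eq_neg_fderiv_mul_of_integrable
    (i2 i) (i1 i) (i3 i) (fun x _ => hfd x) (fun x _ => hg.differentiable_partial _ x)

/-- Second Green identity. -/
lemma integral_mul_lap_comm (hf : ContDiff ℝ 2 f) (hg : ContDiff ℝ 2 g)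
    (hgc : HasCompactSupport g) :
    ∫ x, f x * lap g x = ∫ x, lap f x * g x := by
  rw [integral_mul_lap_eq_neg_gradDot hf hg hgc]
  have hgd : Differentiable ℝ g := hg.differentiable (by simp)
  unfold lap gradDot
  simp_rw [Finset.sum_mul]
  have i1 : ∀ i : Fin N, Integrable fun x => fderiv ℝ (fun y => fderiv ℝ f y
      (EuclideanSpace.single i 1)) x (EuclideanSpace.single i 1) * g x := fun i =>
    ((contDiff_partial (m := 0) (n := 1)
      (contDiff_partial (m := 1) hf (by norm_num [one_add_one_eq_two]) _) (by simp)
        _).continuous.mul hg.continuous).integrable_of_hasCompactSupport hgc.mul_left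
  have i2 : ∀ i : Fin N, Integrable fun x => fderiv ℝ f x (EuclideanSpace.single i 1) *
      fderiv ℝ g x (EuclideanSpace.single i 1) := fun i =>
    ((hf.continuous_partial _).mul (hg.continuous_partial _)).integrable_of_hasCompactSupport
      (hgc.fderiv_apply_const _).mul_left
  have i3 : ∀ i : Fin N, Integrable fun x => fderiv ℝ f x (EuclideanSpace.single i 1) * g x :=
    fun i => ((hf.continuous_partial _).mul hg.continuous).integrable_of_hasCompactSupport
      hgc.mul_left
  rw [integral_finsetSum _ fun i _ => i1 i, integral_finsetSum _ fun i _ => i2 i,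
    ← Finset.sum_neg_distrib]
  exact Finset.sum_congr rfl fun i _ => by
    rw [integral_mul_fderiv_eq_neg_fderiv_mul_of_integrable
      (i1 i) (i2 i) (i3 i) (fun x _ => hf.differentiable_partial _ x) (fun x _ => hgd x), neg_neg]

end Calculus

section Cutoff

variable {N : ℕ}

lemma partial_comp_smul (c : ℝ) (f : EuclideanSpace ℝ (Fin N) → ℝ)
    (x v : EuclideanSpace ℝ (Fin N)) :
    fderiv ℝ (fun y => f (c • y)) x v = c * fderiv ℝ f (c • x) v := by
  have := fderiv_comp_smul (f := f) (x := x) c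
  rw [this]
  simp

lemma lap_comp_smul (c : ℝ) (f : EuclideanSpace ℝ (Fin N) → ℝ) (x : EuclideanSpace ℝ (Fin N)) :
    lap (fun y => f (c • y)) x = c ^ 2 * lap f (c • x) := by
  unfold lap
  rw [Finset.mul_sum]
  refine Finset.sum_congr rfl fun i _ => ?_
  simp_rw [partial_comp_smul]
  rw [partial_comp_smul c (fun z => c * fderiv ℝ f z (EuclideanSpace.single i 1)) x]
  have := fderiv_const_smul_field (𝕜 := ℝ) c
    (f := fun z => fderiv ℝ f z (EuclideanSpace.single i (1 : ℝ)))
  rw [show (fun z => c * fderiv ℝ f z (EuclideanSpace.single i (1 : ℝ))) =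
    c • (fun z => fderiv ℝ f z (EuclideanSpace.single i (1 : ℝ))) from rfl, this]
  simp
  ring

lemma gradDot_comp_smul (c : ℝ) (f : EuclideanSpace ℝ (Fin N) → ℝ)
    (x : EuclideanSpace ℝ (Fin N)) :
    gradDot (fun y => f (c • y)) (fun y => f (c • y)) x = c ^ 2 * gradDot f f (c • x) := by
  unfold gradDot
  rw [Finset.mul_sum]
  refine Finset.sum_congr rfl fun i _ => ?_
  rw [partial_comp_smul]
  ring

/-- Smooth cutoff functions at every scale, with the scale-invariant derivative bounds. -/
lemma exists_cutoff (N : ℕ) : ∃ C : ℝ, 0 < C ∧ ∀ R : ℝ, 0 < R →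
    ∃ η : EuclideanSpace ℝ (Fin N) → ℝ, ContDiff ℝ (⊤ : ℕ∞) η ∧ HasCompactSupport η ∧
      (∀ x, 0 ≤ η x) ∧ (∀ x, η x ≤ 1) ∧ (∀ x, ‖x‖ ≤ R → η x = 1) ∧
      (∀ x, 2 * R ≤ ‖x‖ → η x = 0) ∧
      (∀ x, gradDot η η x ≤ C / R ^ 2) ∧ (∀ x, |lap η x| ≤ C / R ^ 2) := by
  let b : ContDiffBump (0 : EuclideanSpace ℝ (Fin N)) := ⟨1, 2, one_pos, one_lt_two⟩
  have hb : ContDiff ℝ (⊤ : ℕ∞) b := b.contDiff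
  have hb2 : ContDiff ℝ 2 b := b.contDiff
  have hbc : HasCompactSupport b := b.hasCompactSupport
  obtain ⟨C1, h1⟩ := hbc.gradDot.exists_bound_of_continuous (hb2.continuous_gradDot hb2)
  obtain ⟨C2, h2⟩ := hbc.lap.exists_bound_of_continuous hb2.continuous_lap
  refine ⟨max (max C1 C2) 1, by positivity, fun R hR => ⟨fun x => b (R⁻¹ • x), ?_, ?_, ?_, ?_, ?_,
    ?_, ?_, ?_⟩⟩
  · exact hb.comp (contDiff_const_smul _)
  · exact hbc.comp_homeomorph (Homeomorph.smulOfNeZero R⁻¹ (inv_ne_zero hR.ne'))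
  · exact fun x => b.nonneg
  · exact fun x => b.le_one
  · intro x hx
    refine b.one_of_mem_closedBall ?_
    rw [mem_closedBall_zero_iff, norm_smul, norm_inv, norm_of_nonneg hR.le, inv_mul_le_iff₀ hR]
    simpa [b] using hx
  · intro x hx
    refine b.zero_of_le_dist ?_
    rw [dist_zero_right, norm_smul, norm_inv, norm_of_nonneg hR.le, le_inv_mul_iff₀ hR]
    simpa [b, mul_comm] using hx
  · intro x
    rw [gradDot_comp_smul, div_eq_inv_mul, inv_pow]
    gcongr
    exact (le_abs_self _).trans ((h1 _).trans ((le_max_left _ _).trans (le_max_left _ _)))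
  · intro x
    rw [lap_comp_smul, div_eq_inv_mul, inv_pow, abs_mul, abs_of_nonneg (by positivity)]
    gcongr
    exact ((h2 _).trans ((le_max_right _ _).trans (le_max_left _ _)))

end Cutoff

section Mollification

variable {N : ℕ}

open ContinuousLinearMap Convolution Pointwise Filter Topology

lemma partial_convolution {φ f : EuclideanSpace ℝ (Fin N) → ℝ} (hφ : LocallyIntegrable φ)
    (hf : ContDiff ℝ 1 f) (hfc : HasCompactSupport f) (v x : EuclideanSpace ℝ (Fin N)) :
    fderiv ℝ (φ ⋆[lsmul ℝ ℝ, volume] f) x v =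
      (φ ⋆[lsmul ℝ ℝ, volume] fun y => fderiv ℝ f y v) x := by
  rw [(hfc.hasFDerivAt_convolution_right _ hφ hf x).fderiv]
  exact convolution_precompR_apply _ hφ (hfc.fderiv ℝ) (hf.continuous_fderiv one_ne_zero) x v

lemma lap_convolution {φ f : EuclideanSpace ℝ (Fin N) → ℝ} (hφ : LocallyIntegrable φ)
    (hf : ContDiff ℝ 2 f) (hfc : HasCompactSupport f) (x : EuclideanSpace ℝ (Fin N)) :
    lap (φ ⋆[lsmul ℝ ℝ, volume] f) x = (φ ⋆[lsmul ℝ ℝ, volume] lap f) x := by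
  have key : ∀ i : Fin N, fderiv ℝ (fun y => fderiv ℝ (φ ⋆[lsmul ℝ ℝ, volume] f) y
      (EuclideanSpace.single i 1)) x (EuclideanSpace.single i 1) =
      (φ ⋆[lsmul ℝ ℝ, volume] fun y => fderiv ℝ (fun z => fderiv ℝ f z
        (EuclideanSpace.single i 1)) y (EuclideanSpace.single i 1)) x := by
    intro i
    have h1 : (fun y => fderiv ℝ (φ ⋆[lsmul ℝ ℝ, volume] f) y (EuclideanSpace.single i 1)) =
        (φ ⋆[lsmul ℝ ℝ, volume] fun y => fderiv ℝ f y (EuclideanSpace.single i 1)) := by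
      ext y
      exact partial_convolution hφ (hf.of_le (by norm_num)) hfc _ y
    rw [h1]
    exact partial_convolution hφ (contDiff_partial hf (by norm_num [one_add_one_eq_two]) _)
      (hfc.fderiv_apply_const _) _ x
  unfold lap
  simp_rw [key, convolution_def]
  rw [← integral_finsetSum]
  · simp
  · intro i _
    have hc := (hfc.fderiv_apply_const (EuclideanSpace.single i 1)).fderiv_apply_const
      (EuclideanSpace.single i 1)
    exact hc.convolutionExists_right _ hφ (contDiff_partial (m := 0) (n := 1)
      (contDiff_partial (m := 1) hf (by norm_num [one_add_one_eq_two]) _) (by simp)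
        _).continuous x

/-- A compactly supported `C²` function is a bounded pointwise limit, together with its
Laplacian, of test functions supported in a fixed compact set. -/
lemma exists_mollification {f : EuclideanSpace ℝ (Fin N) → ℝ} (hf : ContDiff ℝ 2 f)
    (hfc : HasCompactSupport f) :
    ∃ (F : ℕ → EuclideanSpace ℝ (Fin N) → ℝ) (K : Set (EuclideanSpace ℝ (Fin N))) (M : ℝ),
      IsCompact K ∧ 0 ≤ M ∧ (∀ n, ContDiff ℝ (⊤ : ℕ∞) (F n)) ∧ (∀ n, tsupport (F n) ⊆ K) ∧
      (∀ n x, |F n x| ≤ M) ∧ (∀ n x, |lap (F n) x| ≤ M) ∧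
      (∀ x, Tendsto (fun n => F n x) atTop (𝓝 (f x))) ∧
      (∀ x, Tendsto (fun n => lap (F n) x) atTop (𝓝 (lap f x))) := by
  let b : ℕ → ContDiffBump (0 : EuclideanSpace ℝ (Fin N)) := fun n =>
    ⟨1 / (2 * (n + 1)), 1 / (n + 1), by positivity, by
      rw [div_lt_div_iff_of_pos_left one_pos (by positivity) (by positivity)]
      linarith [(Nat.cast_nonneg n : (0:ℝ) ≤ n)]⟩
  have hb : ∀ n, LocallyIntegrable ((b n).normed volume) := fun n =>
    (b n).integrable_normed.locallyIntegrable
  have hb0 : Tendsto (fun n => (b n).rOut) atTop (𝓝 0) := tendsto_one_div_add_atTop_nhds_zero_nat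
  obtain ⟨C1, h1⟩ := hfc.exists_bound_of_continuous hf.continuous
  obtain ⟨C2, h2⟩ := hfc.lap.exists_bound_of_continuous hf.continuous_lap
  have hC1 : 0 ≤ C1 := (norm_nonneg _).trans (h1 0)
  have bound : ∀ (n : ℕ) (g : EuclideanSpace ℝ (Fin N) → ℝ) (C : ℝ), Continuous g →
      (∀ x, ‖g x‖ ≤ C) → ∀ x, |((b n).normed volume ⋆[lsmul ℝ ℝ, volume] g) x| ≤ C := by
    intro n g C hg hC x
    have := dist_convolution_le (μ := volume) (x₀ := x) (z₀ := (0 : ℝ)) (g := g)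
      (f := (b n).normed volume) ((norm_nonneg _).trans (hC 0)) (b n).support_normed_eq.subset
      (b n).nonneg_normed (b n).integral_normed hg.aestronglyMeasurable
      (fun y _ => by simpa using hC y)
    simpa using this
  have hlap : ∀ n x, lap ((b n).normed volume ⋆[lsmul ℝ ℝ, volume] f) x =
      ((b n).normed volume ⋆[lsmul ℝ ℝ, volume] lap f) x := fun n x =>
    lap_convolution (hb n) hf hfc x
  refine ⟨fun n => (b n).normed volume ⋆[lsmul ℝ ℝ, volume] f,
    Metric.closedBall 0 1 + tsupport f, max C1 C2, (isCompact_closedBall 0 1).add hfc, ?_, ?_, ?_,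
    ?_, ?_, ?_, ?_⟩
  · exact hC1.trans (le_max_left _ _)
  · exact fun n => (b n).hasCompactSupport_normed.contDiff_convolution_left _
      (b n).contDiff_normed hf.continuous.locallyIntegrable
  · intro n
    refine closure_minimal ?_ ((isCompact_closedBall 0 1).add hfc).isClosed
    refine (support_convolution_subset _).trans ?_
    refine Set.add_subset_add ?_ (subset_tsupport f)
    rw [(b n).support_normed_eq]
    refine Metric.ball_subset_closedBall.trans (Metric.closedBall_subset_closedBall ?_)
    change 1 / ((n : ℝ) + 1) ≤ 1
    rw [div_le_one (by positivity)]
    linarith [(Nat.cast_nonneg n : (0:ℝ) ≤ n)]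
  · exact fun n x => (bound n f C1 hf.continuous h1 x).trans (le_max_left _ _)
  · intro n x
    rw [hlap]
    exact (bound n _ C2 hf.continuous_lap h2 x).trans (le_max_right _ _)
  · exact fun x => ContDiffBump.convolution_tendsto_right_of_continuous hb0 hf.continuous x
  · intro x
    simp_rw [hlap]
    exact ContDiffBump.convolution_tendsto_right_of_continuous hb0 hf.continuous_lap x

end Mollification

section Limits

variable {N : ℕ}

open Filter Topology

lemma tendsto_integral_of_bounded_of_support {F : ℕ → EuclideanSpace ℝ (Fin N) → ℝ}
    {f : EuclideanSpace ℝ (Fin N) → ℝ} {K : Set (EuclideanSpace ℝ (Fin N))} (hK : IsCompact K)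
    (hc : ∀ n, Continuous (F n)) {B : EuclideanSpace ℝ (Fin N) → ℝ} (hB : Continuous B)
    (h0 : ∀ n, ∀ x ∉ K, F n x = 0) (hb : ∀ n x, |F n x| ≤ B x)
    (hlim : ∀ x, Tendsto (fun n => F n x) atTop (𝓝 (f x))) :
    Tendsto (fun n => ∫ x, F n x) atTop (𝓝 (∫ x, f x)) := by
  refine tendsto_integral_of_dominated_convergence (K.indicator B)
    (fun n => (hc n).aestronglyMeasurable) ?_ ?_ (Eventually.of_forall hlim)
  · exact (hB.continuousOn.integrableOn_compact hK).integrable_indicator hK.measurableSet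
  · intro n
    refine Eventually.of_forall fun x => ?_
    by_cases hx : x ∈ K
    · simpa [hx] using hb n x
    · simp [hx, h0 n x hx]

/-- A stability inequality for test functions extends to compactly supported `C²` functions. -/
lemma stability_of_contDiff_two {V : EuclideanSpace ℝ (Fin N) → ℝ} (hV : Continuous V)
    (h : ∀ φ : EuclideanSpace ℝ (Fin N) → ℝ, ContDiff ℝ (⊤ : ℕ∞) φ → HasCompactSupport φ →
      ∫ x, V x * φ x ^ 2 ≤ ∫ x, lap φ x ^ 2)
    {φ : EuclideanSpace ℝ (Fin N) → ℝ} (hφ : ContDiff ℝ 2 φ) (hφc : HasCompactSupport φ) :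
    ∫ x, V x * φ x ^ 2 ≤ ∫ x, lap φ x ^ 2 := by
  obtain ⟨F, K, M, hK, hM, hF, hFK, hb, hbl, hlim, hliml⟩ := exists_mollification hφ hφc
  have hF2 : ∀ n, ContDiff ℝ 2 (F n) := fun n => contDiff_infty.1 (hF n) 2
  refine le_of_tendsto_of_tendsto' (f := fun n => ∫ x, V x * F n x ^ 2)
    (g := fun n => ∫ x, lap (F n) x ^ 2)
    (tendsto_integral_of_bounded_of_support hK (fun n => hV.mul ((hF2 n).continuous.pow 2))
      (B := fun x => |V x| * M ^ 2) (by fun_prop) ?_ ?_ ?_)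
    (tendsto_integral_of_bounded_of_support hK (fun n => (hF2 n).continuous_lap.pow 2)
      (B := fun x => M ^ 2) (by fun_prop) ?_ ?_ ?_)
    (fun n => h _ (hF n) (hK.of_isClosed_subset (isClosed_tsupport _) (hFK n)))
  · intro n x hx
    rw [image_eq_zero_of_notMem_tsupport fun h => hx (hFK n h)]
    simp
  · intro n x
    rw [abs_mul, abs_pow]
    have := hb n x
    gcongr
  · exact fun x => ((hlim x).pow 2).const_mul _
  · intro n x hx
    rw [lap_eq_zero fun h => hx (hFK n h)]
    simp
  · intro n x
    rw [abs_pow]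
    have := hbl n x
    gcongr
  · exact fun x => (hliml x).pow 2

/-- A lower bound for the Dirichlet form extends from test functions to compactly supported
`C²` functions. -/
lemma form_bound_of_contDiff_two {W : EuclideanSpace ℝ (Fin N) → ℝ} (hW : Continuous W)
    (h : ∀ φ : EuclideanSpace ℝ (Fin N) → ℝ, ContDiff ℝ (⊤ : ℕ∞) φ → HasCompactSupport φ →
      ∫ x, W x * φ x ^ 2 ≤ ∫ x, -(φ x * lap φ x))
    {φ : EuclideanSpace ℝ (Fin N) → ℝ} (hφ : ContDiff ℝ 2 φ) (hφc : HasCompactSupport φ) :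
    ∫ x, W x * φ x ^ 2 ≤ ∫ x, -(φ x * lap φ x) := by
  obtain ⟨F, K, M, hK, hM, hF, hFK, hb, hbl, hlim, hliml⟩ := exists_mollification hφ hφc
  have hF2 : ∀ n, ContDiff ℝ 2 (F n) := fun n => contDiff_infty.1 (hF n) 2
  refine le_of_tendsto_of_tendsto' (f := fun n => ∫ x, W x * F n x ^ 2)
    (g := fun n => ∫ x, -(F n x * lap (F n) x))
    (tendsto_integral_of_bounded_of_support hK (fun n => hW.mul ((hF2 n).continuous.pow 2))
      (B := fun x => |W x| * M ^ 2) (by fun_prop) ?_ ?_ ?_)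
    (tendsto_integral_of_bounded_of_support hK
      (fun n => ((hF2 n).continuous.mul (hF2 n).continuous_lap).neg)
      (B := fun x => M * M) (by fun_prop) ?_ ?_ ?_)
    (fun n => h _ (hF n) (hK.of_isClosed_subset (isClosed_tsupport _) (hFK n)))
  · intro n x hx
    rw [image_eq_zero_of_notMem_tsupport fun h => hx (hFK n h)]
    simp
  · intro n x
    rw [abs_mul, abs_pow]
    have := hb n x
    gcongr
  · exact fun x => ((hlim x).pow 2).const_mul _
  · intro n x hx
    rw [lap_eq_zero fun h => hx (hFK n h)]
    simp
  · intro n x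
    rw [abs_neg, abs_mul]
    have := hbl n x
    have := hb n x
    gcongr
  · exact fun x => ((hlim x).mul (hliml x)).neg

end Limits

section Schwartz

variable {N : ℕ}

open Filter Topology SchwartzMap Laplacian LineDeriv

lemma SchwartzMap.lap_eq (ψ : 𝓢(EuclideanSpace ℝ (Fin N), ℝ)) (x : EuclideanSpace ℝ (Fin N)) :
    lap ψ x = (Δ ψ) x := by
  rw [laplacian_eq_sum (EuclideanSpace.basisFun (Fin N) ℝ), sum_apply]
  unfold lap
  refine Finset.sum_congr rfl fun i _ => ?_
  rw [lineDerivOp_apply_eq_fderiv]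
  simp only [EuclideanSpace.basisFun_apply]
  congr 2

lemma SchwartzMap.integrable_mul (f g : 𝓢(EuclideanSpace ℝ (Fin N), ℝ)) :
    Integrable fun x => f x * g x :=
  (f.memLp 2).integrable_mul (g.memLp 2)

lemma SchwartzMap.integrable_gradDot (ψ : 𝓢(EuclideanSpace ℝ (Fin N), ℝ)) :
    Integrable (gradDot ψ ψ) := by
  unfold gradDot
  refine integrable_finsetSum _ fun i _ => ?_
  have := (∂_{EuclideanSpace.single i (1 : ℝ)} ψ).integrable_mul
    (∂_{EuclideanSpace.single i (1 : ℝ)} ψ)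
  simpa only [lineDerivOp_apply_eq_fderiv] using this

/-- The stability inequality extends to Schwartz functions, for compactly supported weights. -/
lemma stability_schwartz {V W : EuclideanSpace ℝ (Fin N) → ℝ} (hW : Continuous W)
    (hWc : HasCompactSupport W) (hVc : Continuous V) (hWV : ∀ x, W x ^ 2 ≤ V x)
    (h : ∀ φ : EuclideanSpace ℝ (Fin N) → ℝ, ContDiff ℝ (⊤ : ℕ∞) φ → HasCompactSupport φ →
      ∫ x, V x * φ x ^ 2 ≤ ∫ x, lap φ x ^ 2)
    (ψ : 𝓢(EuclideanSpace ℝ (Fin N), ℝ)) :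
    ∫ x, (W x * ψ x) ^ 2 ≤ ∫ x, lap ψ x ^ 2 := by
  obtain ⟨C, hC, hη⟩ := exists_cutoff N
  choose η h1 h2 h3 h4 h5 _ h7 h8 using fun n : ℕ => hη (n + 1) (by positivity)
  have hη2 : ∀ n, ContDiff ℝ 2 (η n) := fun n => contDiff_infty.1 (h1 n) 2
  have hψ : ContDiff ℝ (⊤ : ℕ∞) ψ := ψ.smooth ⊤
  have hψ2 : ContDiff ℝ 2 ψ := ψ.smooth 2
  have hev : ∀ x, ∀ᶠ n : ℕ in atTop, ∀ᶠ y in 𝓝 x, η n y = 1 := by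
    intro x
    obtain ⟨m, hm⟩ := exists_nat_gt ‖x‖
    filter_upwards [eventually_ge_atTop m] with n hn
    have hlt : ‖x‖ < n + 1 := by
      have : (m : ℝ) ≤ n := by exact_mod_cast hn
      linarith
    filter_upwards [continuous_norm.continuousAt.eventually_lt continuousAt_const hlt] with y hy
    exact h5 n y hy.le
  have hC1 : ∀ n : ℕ, C / ((n : ℝ) + 1) ^ 2 ≤ C := fun n => by
    refine div_le_self hC.le (one_le_pow₀ ?_)
    linarith [(Nat.cast_nonneg n : (0:ℝ) ≤ n)]
  refine le_of_tendsto_of_tendsto' (f := fun n => ∫ x, (W x * (ψ x * η n x)) ^ 2)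
    (g := fun n => ∫ x, lap (fun y => ψ y * η n y) x ^ 2)
    (tendsto_integral_of_bounded_of_support hWc
      (fun n => (hW.mul (ψ.continuous.mul (hη2 n).continuous)).pow 2)
      (B := fun x => (W x * ψ x) ^ 2) ((hW.mul ψ.continuous).pow 2) ?_ ?_ ?_)
    (tendsto_integral_of_dominated_convergence
      (fun x => 3 * (lap ψ x ^ 2 + 4 * C * gradDot ψ ψ x + C ^ 2 * ψ x ^ 2)) ?_ ?_ ?_ ?_)
    (fun n => ?_)
  · intro n x hx
    rw [image_eq_zero_of_notMem_tsupport hx]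
    simp
  · intro n x
    rw [abs_of_nonneg (sq_nonneg _), ← mul_assoc, mul_pow _ (η n x)]
    exact mul_le_of_le_one_right (sq_nonneg _) (pow_le_one₀ (h3 n x) (h4 n x))
  · intro x
    refine tendsto_const_nhds.congr' ?_
    filter_upwards [hev x] with n hn
    rw [hn.self_of_nhds, mul_one]
  · exact fun n => ((hψ2.mul (hη2 n)).continuous_lap.pow 2).aestronglyMeasurable
  · have i1 : Integrable fun x => lap ψ x ^ 2 := by
      simp_rw [SchwartzMap.lap_eq, sq]
      exact (Δ ψ).integrable_mul (Δ ψ)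
    have i2 : Integrable fun x => ψ x ^ 2 := by
      simp_rw [sq]
      exact ψ.integrable_mul ψ
    exact ((i1.add (ψ.integrable_gradDot.const_mul _)).add (i2.const_mul _)).const_mul 3
  · intro n
    refine Eventually.of_forall fun x => ?_
    rw [norm_of_nonneg (sq_nonneg _), lap_mul hψ2 (hη2 n)]
    have e1 : (ψ x * lap (η n) x) ^ 2 ≤ C ^ 2 * ψ x ^ 2 := by
      rw [mul_pow, mul_comm]
      refine mul_le_mul_of_nonneg_right (sq_le_sq.2 ?_) (sq_nonneg _)
      rw [abs_of_pos hC]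
      exact (h8 n x).trans (hC1 n)
    have e2 : gradDot ψ (η n) x ^ 2 ≤ C * gradDot ψ ψ x := by
      refine (gradDot_sq_le _ _ x).trans ?_
      rw [mul_comm]
      exact mul_le_mul_of_nonneg_right ((h7 n x).trans (hC1 n)) (gradDot_self_nonneg _ x)
    have e3 : (η n x * lap ψ x) ^ 2 ≤ lap ψ x ^ 2 := by
      rw [mul_pow]
      exact mul_le_of_le_one_left (sq_nonneg _) (pow_le_one₀ (h3 n x) (h4 n x))
    nlinarith [sq_nonneg (ψ x * lap (η n) x - 2 * gradDot ψ (η n) x),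
      sq_nonneg (ψ x * lap (η n) x - η n x * lap ψ x),
      sq_nonneg (2 * gradDot ψ (η n) x - η n x * lap ψ x)]
  · refine Eventually.of_forall fun x => ?_
    refine tendsto_const_nhds.congr' ?_
    filter_upwards [hev x] with n hn
    rw [lap_mul hψ2 (hη2 n), hn.self_of_nhds]
    have e1 : fderiv ℝ (η n) x = 0 := by
      rw [Filter.EventuallyEq.fderiv_eq (f := fun _ => (1 : ℝ)) hn]
      simp
    have e2 : ∀ᶠ y in 𝓝 x, fderiv ℝ (η n) y = 0 := by
      filter_upwards [hn.eventually_nhds] with y hy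
      rw [Filter.EventuallyEq.fderiv_eq (f := fun _ => (1 : ℝ)) hy]
      simp
    have e3 : gradDot ψ (η n) x = 0 := by simp [gradDot, e1]
    have e4 : lap (η n) x = 0 := by
      unfold lap
      refine Finset.sum_eq_zero fun i _ => ?_
      rw [Filter.EventuallyEq.fderiv_eq (f := fun _ => (0 : ℝ))]
      · simp
      · filter_upwards [e2] with y hy
        simp [hy]
    rw [e3, e4]
    ring
  · refine le_trans (integral_mono ?_ ?_ fun x => ?_)
      (h _ (hψ.mul (h1 n)) (h2 n).mul_left)
    · exact ((hW.mul (ψ.continuous.mul (hη2 n).continuous)).pow 2).integrable_of_hasCompactSupport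
        (HasCompactSupport.intro hWc fun x hx => by
          simp [image_eq_zero_of_notMem_tsupport hx])
    · exact (hVc.mul
        ((ψ.continuous.mul (hη2 n).continuous).pow 2)).integrable_of_hasCompactSupport
        (HasCompactSupport.intro (h2 n) fun x hx => by
          simp [image_eq_zero_of_notMem_tsupport hx])
    · dsimp only
      rw [mul_pow]
      exact mul_le_mul_of_nonneg_right (hWV x) (sq_nonneg _)

end Schwartz

section Resolvent

variable {N : ℕ}

open Filter Topology SchwartzMap Laplacian LineDeriv

lemma hasTemperateGrowth_resolvent_symbol {ε : ℝ} (hε : 0 < ε) :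
    (fun x : EuclideanSpace ℝ (Fin N) => (ε + (2 * π) ^ 2 * ‖x‖ ^ 2)⁻¹).HasTemperateGrowth := by
  have h1 := (Function.hasTemperateGrowth_one_add_norm_sq_rpow (EuclideanSpace ℝ (Fin N)) (-1))
  have h2 : (fun x : EuclideanSpace ℝ (Fin N) => (2 * π / √ε) • x).HasTemperateGrowth := by
    exact ((2 * π / √ε) • ContinuousLinearMap.id ℝ (EuclideanSpace ℝ (Fin N))).hasTemperateGrowth
  have h3 := (Function.HasTemperateGrowth.const ε⁻¹).mul (h1.comp h2)
  have e : (fun x : EuclideanSpace ℝ (Fin N) => (ε + (2 * π) ^ 2 * ‖x‖ ^ 2)⁻¹) =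
      (fun _ => ε⁻¹) * (fun x => (1 + ‖x‖ ^ 2) ^ (-1 : ℝ)) ∘ fun x => (2 * π / √ε) • x := by
    ext x
    simp only [Pi.mul_apply, Function.comp_apply]
    rw [Real.rpow_neg_one, norm_smul, ← mul_inv, mul_add, norm_of_nonneg (by positivity),
      mul_pow (2 * π / √ε), div_pow, sq_sqrt hε.le]
    field_simp
  rw [e]
  exact h3

lemma SchwartzMap.exists_resolvent_complex {ε : ℝ} (hε : 0 < ε)
    (h : 𝓢(EuclideanSpace ℝ (Fin N), ℂ)) :
    ∃ ψ : 𝓢(EuclideanSpace ℝ (Fin N), ℂ), ε • ψ - Δ ψ = h := by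
  have hm := hasTemperateGrowth_resolvent_symbol (N := N) hε
  set m : EuclideanSpace ℝ (Fin N) → ℝ := fun x => (ε + (2 * π) ^ 2 * ‖x‖ ^ 2)⁻¹ with hmdef
  refine ⟨fourierMultiplierCLM ℂ m h, ?_⟩
  have hn : (fun x : EuclideanSpace ℝ (Fin N) => ‖x‖ ^ 2).HasTemperateGrowth := by fun_prop
  rw [laplacian_eq_fourierMultiplierCLM]
  have e : (fun _ : EuclideanSpace ℝ (Fin N) => (1 : ℝ)) =
      (fun x => ∑ i : Fin 2, (![ε • m, (2 * π) ^ 2 • ((fun x => ‖x‖ ^ 2) * m)] i) x) := by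
    ext x
    have : ε + (2 * π) ^ 2 * ‖x‖ ^ 2 ≠ 0 := by positivity
    simp [hmdef]
    field_simp
  have h1 : (ε • m).HasTemperateGrowth := (Function.HasTemperateGrowth.const ε).mul hm
  have h3 : ((fun x : EuclideanSpace ℝ (Fin N) => ‖x‖ ^ 2) * m).HasTemperateGrowth := hn.mul hm
  have h2 : ((2 * π) ^ 2 • ((fun x : EuclideanSpace ℝ (Fin N) => ‖x‖ ^ 2) * m)).HasTemperateGrowth
    := (Function.HasTemperateGrowth.const _).mul h3
  have key : fourierMultiplierCLM ℂ (fun _ : EuclideanSpace ℝ (Fin N) => (1 : ℝ)) h = h := by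
    simp
  rw [e, fourierMultiplierCLM_sum ℂ (by intro i _; fin_cases i <;> assumption), Fin.sum_univ_two]
    at key
  simp only [Matrix.cons_val_zero, Matrix.cons_val_one] at key
  rw [fourierMultiplierCLM_smul hm, fourierMultiplierCLM_smul h3] at key
  rw [fourierMultiplierCLM_fourierMultiplierCLM_apply hn hm, neg_smul, sub_neg_eq_add]
  exact key

lemma SchwartzMap.exists_resolvent {ε : ℝ} (hε : 0 < ε)
    (h : 𝓢(EuclideanSpace ℝ (Fin N), ℝ)) :
    ∃ ψ : 𝓢(EuclideanSpace ℝ (Fin N), ℝ), ∀ x, ε * ψ x - lap ψ x = h x := by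
  obtain ⟨ψ, hψ⟩ := exists_resolvent_complex hε (h.postcompCLM Complex.ofRealCLM)
  refine ⟨ψ.postcompCLM Complex.reCLM, fun x => ?_⟩
  have h1 : (Δ (ψ.postcompCLM Complex.reCLM)) x = ((Δ ψ) x).re := by
    rw [laplacian_eq_sum (EuclideanSpace.basisFun (Fin N) ℝ),
      laplacian_eq_sum (EuclideanSpace.basisFun (Fin N) ℝ), sum_apply, sum_apply, Complex.re_sum]
    refine Finset.sum_congr rfl fun i _ => ?_
    have key : ∀ (f : 𝓢(EuclideanSpace ℝ (Fin N), ℂ)) (w : EuclideanSpace ℝ (Fin N)),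
        ∂_{w} (f.postcompCLM Complex.reCLM) = (∂_{w} f).postcompCLM Complex.reCLM := by
      intro f w
      ext y
      rw [postcompCLM_apply, lineDerivOp_apply_eq_fderiv, lineDerivOp_apply_eq_fderiv]
      exact congrArg (fun L => L w)
        (Complex.reCLM.hasFDerivAt.comp y (f.differentiableAt.hasFDerivAt)).fderiv
    rw [key, key]
    rfl
  have h2 := congrArg (fun f : 𝓢(EuclideanSpace ℝ (Fin N), ℂ) => (f x).re) hψ
  rw [lap_eq, h1]
  simpa using h2

end Resolvent

section OperatorMonotone

/-- If `cⱼ² ≤ bⱼ bⱼ₊₁` and `bⱼ₊₁² ≤ cⱼ cⱼ₊₁` for nonnegative sequences with `b` bounded, then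
`c₀ ≤ b₀`. -/
lemma le_of_logConvex_of_bounded {b c : ℕ → ℝ} {M : ℝ} (hb : ∀ n, 0 ≤ b n)
    (hcb : ∀ n, c n ^ 2 ≤ b n * b (n + 1)) (hbc : ∀ n, b (n + 1) ^ 2 ≤ c n * c (n + 1))
    (hM : ∀ n, b n ≤ M) : c 0 ≤ b 0 := by
  by_contra! hlt
  have hb0 : 0 < b 0 := by
    refine (hb 0).lt_of_ne fun h => ?_
    have := hcb 0
    rw [← h] at this hlt
    nlinarith
  set r := c 0 / b 0 with hr
  have hr1 : 1 < r := (one_lt_div hb0).2 hlt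
  have key : ∀ n, 0 < b n ∧ r * b n ≤ c n ∧ r ^ n * b 0 ≤ b n := by
    intro n
    induction n with
    | zero => exact ⟨hb0, by rw [hr, div_mul_cancel₀ _ hb0.ne'], by simp⟩
    | succ n ih =>
      obtain ⟨h1, h2, h3⟩ := ih
      have hcn : 0 < c n := lt_of_lt_of_le (by positivity) h2
      have h4 : r * c n ≤ b (n + 1) := by
        by_contra! h
        have := hcb n
        nlinarith [mul_lt_mul_of_pos_left h h1, mul_le_mul_of_nonneg_right h2 hcn.le]
      have h5 : 0 < b (n + 1) := lt_of_lt_of_le (by positivity) h4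
      refine ⟨h5, ?_, ?_⟩
      · by_contra! h
        have := hbc n
        nlinarith [mul_lt_mul_of_pos_left h hcn, mul_le_mul_of_nonneg_right h4 h5.le]
      · rw [pow_succ]
        nlinarith
  obtain ⟨n, hn⟩ := pow_unbounded_of_one_lt (M / b 0) hr1
  rw [div_lt_iff₀ hb0] at hn
  linarith [(key n).2.2, hM n]

/-- Operator monotonicity of the square root, for symmetric operators on a pre-Hilbert space:
`W² ≤ L²` implies `W ≤ L`. -/
lemma le_of_sq_le_sq_of_resolvent {V : Type*} [AddCommGroup V] [Module ℝ V]
    (I : V →ₗ[ℝ] V →ₗ[ℝ] ℝ) (W L : V →ₗ[ℝ] V)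
    (hI : ∀ f g, I f g = I g f) (hI0 : ∀ f, 0 ≤ I f f)
    (hW : ∀ f g, I (W f) g = I f (W g)) (hW0 : ∀ f, 0 ≤ I (W f) f)
    (hL : ∀ f g, I (L f) g = I f (L g)) (hL0 : ∀ f, 0 ≤ I (L f) f)
    (hWL : ∀ f, I (W f) (W f) ≤ I (L f) (L f))
    (hres : ∀ ε : ℝ, 0 < ε → ∀ h, ∃ f, ε • f + L f = h) (f : V) :
    I (W f) f ≤ I (L f) f := by
  have main : ∀ ε : ℝ, 0 < ε → I (W f) f ≤ ε * I f f + I (L f) f := by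
    intro ε hε
    choose S hS using hres ε hε
    let A : V →ₗ[ℝ] V := ε • LinearMap.id + L
    have hA : ∀ g, A g = ε • g + L g := fun g => rfl
    let ζ : ℕ → V := fun n => (fun g => S (W g))^[n] f
    have hζ : ∀ n, A (ζ (n + 1)) = W (ζ n) := by
      intro n
      simp only [ζ, Function.iterate_succ_apply', hA, hS]
    have hA0 : ∀ g, 0 ≤ I (A g) g := by
      intro g
      rw [hA]
      simp only [map_add, map_smul, LinearMap.add_apply, LinearMap.smul_apply, smul_eq_mul]
      have := hI0 g
      have := hL0 g
      positivity
    have hAs : ∀ g h, I (A g) h = I (A h) g := by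
      intro g h
      rw [hA, hA]
      simp only [map_add, map_smul, LinearMap.add_apply, LinearMap.smul_apply, smul_eq_mul]
      rw [hI g h, hL g h, hI g (L h)]
    have hWs : ∀ g h, I (W g) h = I (W h) g := fun g h => by rw [hW g h, hI]
    have hsq : ∀ g, I (A g) (A g) =
        ε * (ε * I g g + I (L g) g) + ε * I (L g) g + I (L g) (L g) := by
      intro g
      rw [hA]
      simp only [map_add, map_smul, LinearMap.add_apply, LinearMap.smul_apply, smul_eq_mul]
      rw [hI g (L g)]
      ring
    have hd : ∀ n, I (W (ζ n)) (W (ζ n)) ≤ I (W f) (W f) := by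
      intro n
      induction n with
      | zero => exact le_rfl
      | succ n ih =>
        refine le_trans ((hWL _).trans ?_) ih
        rw [← hζ, hsq]
        have := hI0 (ζ (n + 1))
        have := hL0 (ζ (n + 1))
        have : 0 ≤ ε * (ε * I (ζ (n + 1)) (ζ (n + 1)) + I (L (ζ (n + 1))) (ζ (n + 1))) +
          ε * I (L (ζ (n + 1))) (ζ (n + 1)) := by positivity
        linarith
    have hbM : ∀ n, I (A (ζ (n + 1))) (ζ (n + 1)) ≤ ε⁻¹ * I (W f) (W f) := by
      intro n
      rw [← div_eq_inv_mul, le_div_iff₀ hε]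
      refine le_trans ?_ (hd n)
      rw [← hζ, hsq, hA]
      simp only [map_add, map_smul, LinearMap.add_apply, LinearMap.smul_apply, smul_eq_mul]
      have h1 := hI0 (L (ζ (n + 1)))
      have h2 := hL0 (ζ (n + 1))
      have h3 := mul_nonneg hε.le h2
      linarith
    have hcs1 : ∀ g h, I (A g) h ^ 2 ≤ I (A g) g * I (A h) h := fun g h =>
      LinearMap.BilinForm.apply_sq_le_of_symm (I.comp A) hA0 ⟨fun g h => hAs g h⟩ g h
    have hcs2 : ∀ g h, I (W g) h ^ 2 ≤ I (W g) g * I (W h) h := fun g h =>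
      LinearMap.BilinForm.apply_sq_le_of_symm (I.comp W) hW0 ⟨fun g h => hWs g h⟩ g h
    have := le_of_logConvex_of_bounded (b := fun n => I (A (ζ n)) (ζ n))
      (c := fun n => I (W (ζ n)) (ζ n)) (M := max (I (A f) f) (ε⁻¹ * I (W f) (W f)))
      (fun n => hA0 _) (fun n => ?_) (fun n => ?_) (fun n => ?_)
    · simpa [hA, ζ] using this
    · rw [← hζ, mul_comm]
      exact hcs1 _ _
    · rw [hζ]
      exact hcs2 _ _
    · cases n with
      | zero => exact le_max_left _ _
      | succ n => exact (hbM n).trans (le_max_right _ _)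
  refine le_of_forall_pos_le_add fun δ hδ => ?_
  have h1 : 0 < I f f + 1 := by linarith [hI0 f]
  have := main (δ / (I f f + 1)) (by positivity)
  have h2 : δ / (I f f + 1) * I f f ≤ δ := by
    rw [div_mul_eq_mul_div, div_le_iff₀ h1]
    nlinarith
  linarith

end OperatorMonotone

section StabilitySquareRoot

variable {N : ℕ}

open Filter Topology SchwartzMap Laplacian LineDeriv

/-- The `L²` inner product on Schwartz functions. -/
noncomputable def schwartzInner (N : ℕ) : 𝓢(EuclideanSpace ℝ (Fin N), ℝ) →ₗ[ℝ]
    𝓢(EuclideanSpace ℝ (Fin N), ℝ) →ₗ[ℝ] ℝ :=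
  LinearMap.mk₂ ℝ (fun f g => ∫ x, f x * g x)
    (fun f₁ f₂ g => by
      simp only [add_apply, add_mul]
      exact integral_add (f₁.integrable_mul g) (f₂.integrable_mul g))
    (fun c f g => by
      simp only [smul_apply, smul_eq_mul, mul_assoc]
      exact integral_const_mul _ _)
    (fun f g₁ g₂ => by
      simp only [add_apply, mul_add]
      exact integral_add (f.integrable_mul g₁) (f.integrable_mul g₂))
    (fun c f g => by
      simp only [smul_apply, smul_eq_mul, mul_left_comm _ c]
      exact integral_const_mul _ _)

lemma schwartzInner_apply (f g : 𝓢(EuclideanSpace ℝ (Fin N), ℝ)) :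
    schwartzInner N f g = ∫ x, f x * g x := rfl

lemma schwartzInner_laplacian_self_nonpos (f : 𝓢(EuclideanSpace ℝ (Fin N), ℝ)) :
    ∫ x, (Δ f) x * f x ≤ 0 := by
  have h : ∀ x, (Δ f) x * f x = ∑ i : Fin N, f x *
      (∂_{EuclideanSpace.single i (1 : ℝ)} (∂_{EuclideanSpace.single i (1 : ℝ)} f)) x := by
    intro x
    rw [laplacian_eq_sum (EuclideanSpace.basisFun (Fin N) ℝ), sum_apply, Finset.sum_mul]
    exact Finset.sum_congr rfl fun i _ => by simp [mul_comm]
  simp_rw [h]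
  rw [integral_finsetSum _ fun i _ => f.integrable_mul _]
  refine Finset.sum_nonpos fun i _ => ?_
  rw [integral_mul_lineDerivOp_right_eq_neg_left]
  exact neg_nonpos.2 (integral_nonneg fun x => mul_self_nonneg _)

/-- If `W²` is dominated by a stable potential then `W ≤ -Δ` as quadratic forms on Schwartz
functions, for smooth compactly supported nonnegative `W`. -/
lemma form_bound_schwartz {W V : EuclideanSpace ℝ (Fin N) → ℝ} (hW : ContDiff ℝ (⊤ : ℕ∞) W)
    (hWc : HasCompactSupport W) (hW0 : ∀ x, 0 ≤ W x) (hVc : Continuous V)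
    (hWV : ∀ x, W x ^ 2 ≤ V x)
    (h : ∀ φ : EuclideanSpace ℝ (Fin N) → ℝ, ContDiff ℝ (⊤ : ℕ∞) φ → HasCompactSupport φ →
      ∫ x, V x * φ x ^ 2 ≤ ∫ x, lap φ x ^ 2) (ψ : 𝓢(EuclideanSpace ℝ (Fin N), ℝ)) :
    ∫ x, W x * ψ x ^ 2 ≤ ∫ x, -(ψ x * lap ψ x) := by
  have hWt : W.HasTemperateGrowth := (hWc.toSchwartzMap hW).hasTemperateGrowth
  have key := le_of_sq_le_sq_of_resolvent (schwartzInner N)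
    (smulLeftCLM ℝ W : 𝓢(EuclideanSpace ℝ (Fin N), ℝ) →L[ℝ] 𝓢(EuclideanSpace ℝ (Fin N), ℝ))
    (-(laplacianCLM ℝ (EuclideanSpace ℝ (Fin N)) 𝓢(EuclideanSpace ℝ (Fin N), ℝ)).toLinearMap)
    (fun f g => ?_) (fun f => ?_) (fun f g => ?_) (fun f => ?_) (fun f g => ?_) (fun f => ?_)
    (fun f => ?_) (fun ε hε f => ?_) ψ
  · simp only [schwartzInner_apply, ContinuousLinearMap.coe_coe, smulLeftCLM_apply_apply hWt,
      smul_eq_mul, LinearMap.neg_apply, neg_apply, laplacianCLM_eq] at key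
    simp only [lap_eq]
    convert key using 3 <;> ring
  · simp only [schwartzInner_apply, mul_comm]
  · exact integral_nonneg fun x => mul_self_nonneg _
  · simp only [schwartzInner_apply, ContinuousLinearMap.coe_coe, smulLeftCLM_apply_apply hWt,
      smul_eq_mul]
    congr 1
    ext x
    ring
  · simp only [schwartzInner_apply, ContinuousLinearMap.coe_coe, smulLeftCLM_apply_apply hWt,
      smul_eq_mul, mul_assoc]
    exact integral_nonneg fun x => mul_nonneg (hW0 x) (mul_self_nonneg _)
  · simp only [schwartzInner_apply, LinearMap.neg_apply, ContinuousLinearMap.coe_coe,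
      neg_apply, laplacianCLM_eq, neg_mul, mul_neg, integral_neg]
    rw [integral_mul_laplacian_right_eq_left]
  · simp only [schwartzInner_apply, LinearMap.neg_apply, ContinuousLinearMap.coe_coe,
      neg_apply, laplacianCLM_eq, neg_mul, integral_neg]
    exact neg_nonneg.2 (schwartzInner_laplacian_self_nonpos f)
  · simp only [schwartzInner_apply, LinearMap.neg_apply, ContinuousLinearMap.coe_coe,
      neg_apply, laplacianCLM_eq, smulLeftCLM_apply_apply hWt, smul_eq_mul,
      neg_mul_neg]
    have := stability_schwartz hW.continuous hWc hVc hWV h f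
    simpa only [lap_eq, sq] using this
  · obtain ⟨g, hg⟩ := f.exists_resolvent hε
    refine ⟨g, ?_⟩
    ext x
    simp only [LinearMap.neg_apply, ContinuousLinearMap.coe_coe,
      neg_apply, laplacianCLM_eq, add_apply, smul_apply,
      smul_eq_mul]
    rw [← hg x, lap_eq]
    ring

/-- The stability inequality for the bilaplacian with potential `W²` implies the corresponding
inequality for the Laplacian with potential `W`. -/
lemma form_bound_of_stability {W V : EuclideanSpace ℝ (Fin N) → ℝ} (hW : Continuous W)
    (hW0 : ∀ x, 0 < W x) (hVc : Continuous V) (hWV : ∀ x, W x ^ 2 ≤ V x)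
    (h : ∀ φ : EuclideanSpace ℝ (Fin N) → ℝ, ContDiff ℝ (⊤ : ℕ∞) φ → HasCompactSupport φ →
      ∫ x, V x * φ x ^ 2 ≤ ∫ x, lap φ x ^ 2)
    {φ : EuclideanSpace ℝ (Fin N) → ℝ} (hφ : ContDiff ℝ 2 φ) (hφc : HasCompactSupport φ) :
    ∫ x, W x * φ x ^ 2 ≤ ∫ x, -(φ x * lap φ x) := by
  refine form_bound_of_contDiff_two hW (fun ζ hζ hζc => ?_) hφ hφc
  have key : ∀ δ : ℝ, 0 < δ → δ ≤ 1 / 2 →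
      (1 - 2 * δ) * ∫ x, W x * ζ x ^ 2 ≤ ∫ x, -(ζ x * lap ζ x) := by
    intro δ hδ hδ2
    obtain ⟨g, hg, hgd, -⟩ := Continuous.exists_contDiff_approx (f := fun x => (1 - δ) * W x)
      (ε := fun x => δ * W x) ⊤ (by fun_prop) (by fun_prop) (fun x => mul_pos hδ (hW0 x))
    have hg' : ∀ x, (1 - 2 * δ) * W x ≤ g x ∧ g x ≤ W x := by
      intro x
      have := hgd x
      rw [Real.dist_eq, abs_lt] at this
      constructor <;> nlinarith [this.1, this.2]
    have hg0 : ∀ x, 0 ≤ g x := fun x =>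
      le_trans (mul_nonneg (by linarith) (hW0 x).le) (hg' x).1
    obtain ⟨r, hr, hrζ⟩ := hζc.isCompact.isBounded.subset_closedBall_lt 0 0
    obtain ⟨C, -, hη⟩ := exists_cutoff N
    obtain ⟨η, h1, h2, h3, h4, h5, -⟩ := hη r hr
    have := form_bound_schwartz (W := fun x => η x * g x) (h1.mul hg) h2.mul_right
      (fun x => mul_nonneg (h3 x) (hg0 x)) hVc (fun x => (pow_le_pow_left₀
        (mul_nonneg (h3 x) (hg0 x))
          ((mul_le_of_le_one_left (hg0 x) (h4 x)).trans (hg' x).2) 2).trans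
        (hWV x)) h (hζc.toSchwartzMap hζ)
    refine le_trans ?_ this
    rw [← integral_const_mul]
    have hz : ∀ x, (hζc.toSchwartzMap hζ) x = ζ x := fun x => rfl
    refine integral_mono ?_ ?_ fun x => ?_
    · exact (continuous_const.mul (hW.mul (hζ.continuous.pow 2))).integrable_of_hasCompactSupport
        (HasCompactSupport.intro hζc fun x hx => by simp [image_eq_zero_of_notMem_tsupport hx])
    · exact ((h1.continuous.mul hg.continuous).mul
        (hζ.continuous.pow 2)).integrable_of_hasCompactSupport
        (HasCompactSupport.intro hζc fun x hx => by simp [image_eq_zero_of_notMem_tsupport hx])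
    · dsimp only
      rw [hz, ← mul_assoc]
      by_cases hx : x ∈ tsupport ζ
      · rw [h5 x (by simpa using hrζ hx), one_mul]
        exact mul_le_mul_of_nonneg_right (hg' x).1 (sq_nonneg _)
      · simp [image_eq_zero_of_notMem_tsupport hx]
  have hA : 0 ≤ ∫ x, W x * ζ x ^ 2 :=
    integral_nonneg fun x => mul_nonneg (hW0 x).le (sq_nonneg _)
  set A := ∫ x, W x * ζ x ^ 2
  set D := ∫ x, -(ζ x * lap ζ x)
  have hD := key (1 / 2) (by norm_num) le_rfl
  by_contra! hlt
  have h1 := key ((A - D) / (4 * (A + 1))) (div_pos (by linarith) (by linarith)) (by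
    rw [div_le_iff₀ (by linarith)]
    linarith)
  have h2 : (A - D) / (4 * (A + 1)) * (4 * (A + 1)) = A - D := div_mul_cancel₀ _ (by positivity)
  have h3 : 0 ≤ (A - D) / (4 * (A + 1)) := div_nonneg (by linarith) (by linarith)
  nlinarith

end StabilitySquareRoot

section Powers

variable {N : ℕ} {f g : EuclideanSpace ℝ (Fin N) → ℝ}

lemma Continuous.integrable_of_eq_zero {K : Set (EuclideanSpace ℝ (Fin N))} (hf : Continuous f)
    (hK : IsCompact K) (h : ∀ x ∉ K, f x = 0) : Integrable f :=
  hf.integrable_of_hasCompactSupport (HasCompactSupport.intro hK h)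

lemma ContDiff.rpow_of_pos {n : WithTop ℕ∞} (hf : ContDiff ℝ n f) (h0 : ∀ x, 0 < f x) (r : ℝ) :
    ContDiff ℝ n fun y => f y ^ r :=
  hf.rpow_const_of_ne fun x => (h0 x).ne'

lemma lap_rpow (hf : ContDiff ℝ 2 f) (h0 : ∀ x, 0 < f x) (r : ℝ) (x : EuclideanSpace ℝ (Fin N)) :
    lap (fun y => f y ^ r) x =
      r * f x ^ (r - 1) * lap f x + r * (r - 1) * f x ^ (r - 2) * gradDot f f x := by
  refine lap_comp (φ := fun t => t ^ r) (φ' := fun t => r * t ^ (r - 1))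
    (φ'' := fun t => r * (r - 1) * t ^ (r - 2)) hf (fun y => ?_) (fun y => ?_) x
  · exact Real.hasDerivAt_rpow_const (Or.inl (h0 y).ne')
  · have := (Real.hasDerivAt_rpow_const (x := f y) (p := r - 1) (Or.inl (h0 y).ne')).const_mul r
    refine this.congr_deriv ?_
    rw [mul_assoc, show r - 1 - 1 = r - 2 by ring]

lemma lap_pow (hf : ContDiff ℝ 2 f) (n : ℕ) (x : EuclideanSpace ℝ (Fin N)) :
    lap (fun y => f y ^ n) x =
      n * f x ^ (n - 1) * lap f x + n * (n - 1 : ℕ) * f x ^ (n - 2) * gradDot f f x := by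
  refine lap_comp (φ := fun t => t ^ n) (φ' := fun t => n * t ^ (n - 1))
    (φ'' := fun t => n * (n - 1 : ℕ) * t ^ (n - 2)) hf (fun y => ?_) (fun y => ?_) x
  · exact hasDerivAt_pow n _
  · have := (hasDerivAt_pow (n - 1) (f y)).const_mul (n : ℝ)
    refine this.congr_deriv ?_
    rw [mul_assoc]
    rfl

lemma gradDot_pow (hf : ContDiff ℝ 2 f) (n : ℕ) (x : EuclideanSpace ℝ (Fin N)) :
    gradDot (fun y => f y ^ n) g x = n * f x ^ (n - 1) * gradDot f g x :=
  gradDot_comp (φ := fun t => t ^ n) (φ' := fun t => n * t ^ (n - 1)) hf x (hasDerivAt_pow n _) g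

lemma abs_lap_pow_le (hf : ContDiff ℝ 2 f) {x : EuclideanSpace ℝ (Fin N)} {D : ℝ}
    (h0 : 0 ≤ f x) (h1 : f x ≤ 1) (hg : gradDot f f x ≤ D) (hl : |lap f x| ≤ D) (n : ℕ) :
    |lap (fun y => f y ^ (n + 2)) x| ≤ ((n : ℝ) + 2) ^ 2 * D * f x ^ n := by
  rw [lap_pow hf]
  have hD : 0 ≤ D := (abs_nonneg _).trans hl
  have hp : f x ^ (n + 1) ≤ f x ^ n := pow_le_pow_of_le_one h0 h1 (by omega)
  have e1 : n + 2 - 1 = n + 1 := rfl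
  have e2 : n + 2 - 2 = n := rfl
  rw [e1, e2]
  push_cast
  have a1 : |((n : ℝ) + 2) * f x ^ (n + 1) * lap f x| ≤ ((n : ℝ) + 2) * f x ^ n * D := by
    rw [abs_mul, abs_of_nonneg (by positivity)]
    gcongr
  have a2 : |((n : ℝ) + 2) * (n + 1) * f x ^ n * gradDot f f x| ≤
      ((n : ℝ) + 2) * (n + 1) * f x ^ n * D := by
    rw [abs_mul, abs_of_nonneg (by positivity), abs_of_nonneg (gradDot_self_nonneg f x)]
    gcongr
  refine (abs_add_le _ _).trans ((add_le_add a1 a2).trans (le_of_eq ?_))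
  ring

end Powers

section KeyInequality

variable {N : ℕ} {f : EuclideanSpace ℝ (Fin N) → ℝ}

/-- Testing the form bound `W ≤ -Δ` with `h ^ (r / 2) * η`. -/
lemma integral_mul_rpow_le {W h η : EuclideanSpace ℝ (Fin N) → ℝ}
    (hform : ∀ φ : EuclideanSpace ℝ (Fin N) → ℝ, ContDiff ℝ 2 φ → HasCompactSupport φ →
      ∫ x, W x * φ x ^ 2 ≤ ∫ x, -(φ x * lap φ x))
    (hh : ContDiff ℝ 2 h) (h0 : ∀ x, 0 < h x) {r : ℝ} (hr : 1 < r)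
    (hη : ContDiff ℝ 2 η) (hηc : HasCompactSupport η) (hη0 : ∀ x, 0 ≤ η x) (hη1 : ∀ x, η x ≤ 1)
    {D : ℝ} (hg : ∀ x, gradDot η η x ≤ D) (hl : ∀ x, |lap η x| ≤ D)
    {K : Set (EuclideanSpace ℝ (Fin N))} (hK : IsCompact K) (hηK : tsupport η ⊆ K) :
    ∫ x, W x * (h x ^ r * η x ^ 2) ≤
      r ^ 2 / (4 * (r - 1)) * (∫ x, h x ^ (r - 1) * -lap h x * η x ^ 2) +
        (3 + |(r - 2) / (r - 1)|) * D * ∫ x in K, h x ^ r := by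
  have hF : ContDiff ℝ 2 fun x => h x ^ r := hh.rpow_of_pos h0 r
  have hf : ContDiff ℝ 2 fun x => h x ^ (r / 2) := hh.rpow_of_pos h0 _
  have hq : ContDiff ℝ 2 fun x => η x ^ 2 := hη.pow 2
  have hqc : HasCompactSupport fun x => η x ^ 2 :=
    HasCompactSupport.intro hηc fun x hx => by simp [image_eq_zero_of_notMem_tsupport hx]
  have hz : ∀ x ∉ tsupport η, η x = 0 := fun x hx => image_eq_zero_of_notMem_tsupport hx
  have hts : tsupport (fun y => η y ^ 2) ⊆ tsupport η :=
    closure_mono fun y hy => by simpa using hy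
  have hz3 : ∀ x ∉ tsupport η, lap (fun y => η y ^ 2) x = 0 := fun x hx =>
    lap_eq_zero fun h' => hx (hts h')
  have hz4 : ∀ x ∉ tsupport η, gradDot (fun y => h y ^ r) (fun y => η y ^ 2) x = 0 := fun x hx =>
    gradDot_eq_zero fun h' => hx (hts h')
  have hc1 : Continuous fun x => h x ^ (r - 1) * -lap h x * η x ^ 2 :=
    (((hh.rpow_of_pos h0 _).continuous.mul hh.continuous_lap.neg).mul (hη.continuous.pow 2))
  have i1 : Integrable fun x => h x ^ (r - 1) * -lap h x * η x ^ 2 :=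
    hc1.integrable_of_eq_zero hηc fun x hx => by simp [hz x hx]
  have i2 : Integrable fun x => lap (fun y => h y ^ r) x * η x ^ 2 :=
    (hF.continuous_lap.mul (hη.continuous.pow 2)).integrable_of_eq_zero hηc fun x hx => by
      simp [hz x hx]
  have i3 : Integrable fun x => h x ^ r * (η x * lap η x) :=
    (hF.continuous.mul (hη.continuous.mul hη.continuous_lap)).integrable_of_eq_zero hηc
      fun x hx => by simp [hz x hx]
  have i4 : Integrable (gradDot (fun y => h y ^ r) (fun y => η y ^ 2)) :=
    (hF.continuous_gradDot hq).integrable_of_eq_zero hηc hz4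
  have i5 : Integrable fun x => h x ^ r * lap (fun y => η y ^ 2) x :=
    (hF.continuous.mul hq.continuous_lap).integrable_of_eq_zero hηc fun x hx => by
      show h x ^ r * lap (fun y => η y ^ 2) x = 0
      rw [hz3 x hx, mul_zero]
  have hpt : ∀ x, -((h x ^ (r / 2) * η x) * lap (fun y => h y ^ (r / 2) * η y) x) =
      r ^ 2 / (4 * (r - 1)) * (h x ^ (r - 1) * -lap h x * η x ^ 2) -
        (r - 2) / (4 * (r - 1)) * (lap (fun y => h y ^ r) x * η x ^ 2) -
        h x ^ r * (η x * lap η x) - 1 / 2 * gradDot (fun y => h y ^ r) (fun y => η y ^ 2) x := by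
    intro x
    have hr1 : r - 1 ≠ 0 := by linarith
    rw [lap_mul hf hη, lap_rpow hh h0, lap_rpow hh h0, gradDot_comm _ (fun y => η y ^ 2),
      gradDot_pow hη, gradDot_comm η,
      gradDot_comp (φ := fun t => t ^ r) (φ' := fun t => r * t ^ (r - 1)) hh x
        (Real.hasDerivAt_rpow_const (Or.inl (h0 x).ne')),
      gradDot_comp (φ := fun t => t ^ (r / 2)) (φ' := fun t => r / 2 * t ^ (r / 2 - 1)) hh x
        (Real.hasDerivAt_rpow_const (Or.inl (h0 x).ne'))]
    have e1 : h x ^ r = h x ^ (r / 2) * h x ^ (r / 2) := by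
      rw [← rpow_add (h0 x)]; ring_nf
    have e2 : h x ^ (r - 1) = h x ^ (r / 2) * h x ^ (r / 2 - 1) := by
      rw [← rpow_add (h0 x)]; ring_nf
    have e3 : h x ^ (r - 2) = h x ^ (r / 2) * h x ^ (r / 2 - 2) := by
      rw [← rpow_add (h0 x)]; ring_nf
    rw [e1, e2, e3]
    field_simp
    push_cast
    ring
  have hmain := hform _ (hf.mul hη) hηc.mul_left
  have e0 : ∀ x, W x * (h x ^ (r / 2) * η x) ^ 2 = W x * (h x ^ r * η x ^ 2) := by
    intro x
    rw [mul_pow, ← rpow_natCast (h x ^ (r / 2)), ← rpow_mul (h0 x).le]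
    norm_num
  simp_rw [e0] at hmain
  refine hmain.trans ?_
  simp_rw [hpt]
  have j1 := i1.const_mul (r ^ 2 / (4 * (r - 1)))
  have j2 := i2.const_mul ((r - 2) / (4 * (r - 1)))
  have j4 := i4.const_mul (1 / 2)
  have j12 : Integrable fun x => r ^ 2 / (4 * (r - 1)) * (h x ^ (r - 1) * -lap h x * η x ^ 2) -
      (r - 2) / (4 * (r - 1)) * (lap (fun y => h y ^ r) x * η x ^ 2) := j1.sub j2
  have j123 : Integrable fun x =>
      r ^ 2 / (4 * (r - 1)) * (h x ^ (r - 1) * -lap h x * η x ^ 2) -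
      (r - 2) / (4 * (r - 1)) * (lap (fun y => h y ^ r) x * η x ^ 2) -
      h x ^ r * (η x * lap η x) := j12.sub i3
  rw [integral_sub j123 j4, integral_sub j12 i3, integral_sub j1 j2, integral_const_mul,
    integral_const_mul,
    integral_const_mul, ← integral_mul_lap_comm hF hq hqc]
  have e4 : ∫ x, gradDot (fun y => h y ^ r) (fun y => η y ^ 2) x =
      -∫ x, h x ^ r * lap (fun y => η y ^ 2) x := by
    rw [integral_mul_lap_eq_neg_gradDot hF hq hqc, neg_neg]
  rw [e4]
  have e5 : ∫ x, ((1 / 2 - (r - 2) / (4 * (r - 1))) * (h x ^ r * lap (fun y => η y ^ 2) x) -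
      h x ^ r * (η x * lap η x)) ≤ (3 + |(r - 2) / (r - 1)|) * D * ∫ x in K, h x ^ r := by
    rw [← integral_const_mul, ← integral_indicator hK.measurableSet]
    refine integral_mono ((i5.const_mul _).sub i3) ?_ fun x => ?_
    · exact IntegrableOn.integrable_indicator
        ((hF.continuous.continuousOn.integrableOn_compact hK).const_mul _) hK.measurableSet
    · by_cases hx : x ∈ K
      · have hp : 0 < h x ^ r := rpow_pos_of_pos (h0 x) r
        have b1 : |lap (fun y => η y ^ 2) x| ≤ 4 * D := by
          have := abs_lap_pow_le hη (hη0 x) (hη1 x) (hg x) (hl x) 0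
          norm_num at this
          exact this
        have b2 : |η x * lap η x| ≤ D := by
          rw [abs_mul, abs_of_nonneg (hη0 x)]
          exact (mul_le_of_le_one_left (abs_nonneg _) (hη1 x)).trans (hl x)
        have b3 : |(1 / 2 - (r - 2) / (4 * (r - 1)))| ≤ 1 / 2 + |(r - 2) / (r - 1)| / 4 := by
          refine (abs_sub _ _).trans (le_of_eq ?_)
          rw [mul_comm 4, ← div_div, abs_div _ (4 : ℝ)]
          norm_num
        have b4 : (1 / 2 - (r - 2) / (4 * (r - 1))) * lap (fun y => η y ^ 2) x ≤
            (1 / 2 + |(r - 2) / (r - 1)| / 4) * (4 * D) := by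
          refine (le_abs_self _).trans ?_
          rw [abs_mul]
          gcongr
        simp only [Set.indicator_of_mem hx]
        have : (1 / 2 - (r - 2) / (4 * (r - 1))) * lap (fun y => η y ^ 2) x - η x * lap η x ≤
            (3 + |(r - 2) / (r - 1)|) * D := by
          linarith [neg_le_of_abs_le b2]
        have := mul_le_mul_of_nonneg_left this hp.le
        linarith
      · have hx' : x ∉ tsupport η := fun h' => hx (hηK h')
        simp only [Set.indicator_of_notMem hx]
        rw [hz3 x hx', hz x hx']
        simp
  rw [integral_sub (i5.const_mul _) i3, integral_const_mul] at e5
  linarith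

end KeyInequality

section Energy

variable {N : ℕ}

/-- Algebra behind the energy estimate. -/
lemma add_le_of_energy_inequalities {p M X Y PA S T Q : ℝ} (hp : 1 < p) (hM : 1 ≤ M)
    (h1 : (p - 1) * X ≤ PA + 2 * M * S)
    (h2 : Y ≤ X + 1 / 2 * Y + 2 * PA + 2 * M * S) (h3 : PA ≤ 8 * M * T + 2 * M ^ 2 * Q)
    (h4 : T ≤ S + 2 * M * Q) (h5 : ∀ δ > 0, S ≤ δ * Y + 1 / (4 * δ) * Q) (hX : 0 ≤ X) :
    X + Y ≤ ((30 * M / (p - 1) + 36 * M) ^ 2 + 2 * (54 * M ^ 2 / (p - 1) + 72 * M ^ 2)) * Q := by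
  have hp' : 0 < p - 1 := by linarith
  set α := 30 * M / (p - 1) + 36 * M with hα
  set β := 54 * M ^ 2 / (p - 1) + 72 * M ^ 2 with hβ
  have hα0 : 0 < α := by positivity
  have h6 : PA ≤ 8 * M * S + 18 * M ^ 2 * Q := by
    have := mul_le_mul_of_nonneg_left h4 (by positivity : 0 ≤ 8 * M)
    linarith
  have h7 : X ≤ (10 * M * S + 18 * M ^ 2 * Q) / (p - 1) := by
    rw [le_div_iff₀ hp']
    linarith
  have h8 : X + Y ≤ α * S + β * Q := by
    have e : α * S + β * Q = 3 * ((10 * M * S + 18 * M ^ 2 * Q) / (p - 1)) +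
        36 * M * S + 72 * M ^ 2 * Q := by
      rw [hα, hβ]
      field_simp
      ring
    rw [e]
    linarith
  have h9 := mul_le_mul_of_nonneg_left (h5 (1 / (2 * α)) (by positivity)) hα0.le
  have e : α * (1 / (2 * α) * Y + 1 / (4 * (1 / (2 * α))) * Q) = Y / 2 + α ^ 2 / 2 * Q := by
    field_simp
    ring
  rw [e] at h9
  linarith

/-- The energy estimate for stable solutions with a power of a cutoff function. -/
lemma integral_energy_mul_pow_le {p : ℝ} (hp : 1 < p) {u : EuclideanSpace ℝ (Fin N) → ℝ}
    (hu : ContDiff ℝ 4 u) (hu0 : ∀ x, 0 < u x) (hpde : ∀ x, lap (lap u) x = u x ^ p)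
    (hstab : ∀ φ : EuclideanSpace ℝ (Fin N) → ℝ, ContDiff ℝ 2 φ → HasCompactSupport φ →
      ∫ x, p * u x ^ (p - 1) * φ x ^ 2 ≤ ∫ x, lap φ x ^ 2)
    {η : EuclideanSpace ℝ (Fin N) → ℝ}
    (hη : ContDiff ℝ 2 η) (hηc : HasCompactSupport η) (hη0 : ∀ x, 0 ≤ η x) (hη1 : ∀ x, η x ≤ 1)
    {D : ℝ} (hg : ∀ x, gradDot η η x ≤ D) (hl : ∀ x, |lap η x| ≤ D) {n : ℕ} (hn : n ≠ 0) :
    (∫ x, u x ^ (p + 1) * η x ^ (2 * n + 4)) + ∫ x, lap u x ^ 2 * η x ^ (2 * n + 4) ≤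
      ((30 * ((n : ℝ) + 2) ^ 2 / (p - 1) + 36 * ((n : ℝ) + 2) ^ 2) ^ 2 +
        2 * (54 * (((n : ℝ) + 2) ^ 2) ^ 2 / (p - 1) + 72 * (((n : ℝ) + 2) ^ 2) ^ 2)) *
        ∫ x, D ^ 2 * u x ^ 2 * η x ^ (2 * n) := by
  set w := lap u with hw
  set M : ℝ := ((n : ℝ) + 2) ^ 2 with hM
  have hM1 : 1 ≤ M := by rw [hM]; nlinarith [(Nat.cast_nonneg n : (0 : ℝ) ≤ n)]
  have hD : 0 ≤ D := (abs_nonneg _).trans (hl 0)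
  have hu2 : ContDiff ℝ 2 u := hu.of_le (by norm_num)
  have hw2 : ContDiff ℝ 2 w := contDiff_lap hu (by norm_num)
  have hup : Continuous fun x => u x ^ (p + 1) := (hu2.rpow_of_pos hu0 _).continuous
  have hψ : ContDiff ℝ 2 fun x => η x ^ (n + 2) := hη.pow _
  have hψ2 : ContDiff ℝ 2 fun x => η x ^ (2 * n + 4) := hη.pow _
  have hgg : ContDiff ℝ 2 fun x => η x ^ (2 * n + 2) := hη.pow _
  have hz : ∀ x ∉ tsupport η, η x = 0 := fun x hx => image_eq_zero_of_notMem_tsupport hx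
  have hpc : ∀ k : ℕ, k ≠ 0 → HasCompactSupport fun x => η x ^ k := fun k hk =>
    HasCompactSupport.intro hηc fun x hx => by simp [hz x hx, hk]
  have hci : ∀ (F : EuclideanSpace ℝ (Fin N) → ℝ) (k : ℕ), Continuous F → k ≠ 0 →
      Integrable fun x => F x * η x ^ k := fun F k hF hk =>
    (hF.mul (hη.continuous.pow k)).integrable_of_eq_zero hηc fun x hx => by simp [hz x hx, hk]
  have hgc : Continuous (gradDot u u) := hu2.continuous_gradDot hu2
  set A : EuclideanSpace ℝ (Fin N) → ℝ := fun x =>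
    2 * gradDot u (fun y => η y ^ (n + 2)) x + u x * lap (fun y => η y ^ (n + 2)) x with hA
  have hAc : Continuous A :=
    ((hu2.continuous_gradDot hψ).const_mul 2).add (hu2.continuous.mul hψ.continuous_lap)
  set G : EuclideanSpace ℝ (Fin N) → ℝ := gradDot (fun y => η y ^ (n + 2)) fun y => η y ^ (n + 2)
    with hG
  have hGc : Continuous G := hψ.continuous_gradDot hψ
  have hts : tsupport (fun y => η y ^ (n + 2)) ⊆ tsupport η :=
    closure_mono fun y hy => by
      intro h0
      exact hy (by simp [h0])
  have hA0 : ∀ x ∉ tsupport η, A x = 0 := fun x hx => by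
    have hx' : x ∉ tsupport fun y => η y ^ (n + 2) := fun h' => hx (hts h')
    simp only [hA]
    rw [gradDot_eq_zero hx', lap_eq_zero hx']
    ring
  have hG0 : ∀ x, 0 ≤ G x := gradDot_self_nonneg _
  have hGle : ∀ x, G x ≤ M * D * η x ^ (2 * n + 2) := fun x => by
    rw [hG, gradDot_pow hη, gradDot_comm, gradDot_pow hη, hM]
    have : 0 ≤ ((n : ℝ) + 2) ^ 2 * η x ^ (2 * n + 2) := by have := hη0 x; positivity
    have := mul_le_mul_of_nonneg_left (hg x) this
    have e : n + 2 - 1 = n + 1 := rfl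
    rw [e]
    push_cast
    calc _ = ((n : ℝ) + 2) ^ 2 * η x ^ (2 * n + 2) * gradDot η η x := by ring
      _ ≤ _ := this
      _ = _ := by ring
  have hGz : ∀ x ∉ tsupport η, G x = 0 := fun x hx =>
    gradDot_eq_zero fun h' => hx (hts h')
  have hAle : ∀ x, A x ^ 2 ≤ 8 * M * (D * gradDot u u x * η x ^ (2 * n + 2)) +
      2 * M ^ 2 * (D ^ 2 * u x ^ 2 * η x ^ (2 * n)) := fun x => by
    have c1 := gradDot_sq_le u (fun y => η y ^ (n + 2)) x
    have c2 := mul_le_mul_of_nonneg_left (hGle x) (gradDot_self_nonneg u x)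
    have c3 := abs_lap_pow_le hη (hη0 x) (hη1 x) (hg x) (hl x) n
    have c4 : (u x * lap (fun y => η y ^ (n + 2)) x) ^ 2 ≤ u x ^ 2 * (M * D * η x ^ n) ^ 2 := by
      rw [mul_pow, ← sq_abs (lap _ x)]
      gcongr
    have c5 : (M * D * η x ^ n) ^ 2 = M ^ 2 * D ^ 2 * η x ^ (2 * n) := by ring
    rw [c5] at c4
    have c6 := add_sq_le (a := 2 * gradDot u (fun y => η y ^ (n + 2)) x)
      (b := u x * lap (fun y => η y ^ (n + 2)) x)
    simp only [hA]
    linarith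
  have hlap1 : ∀ x, lap (fun y => u y * η y ^ (n + 2)) x = η x ^ (n + 2) * w x + A x := fun x => by
    rw [lap_mul hu2 hψ]
    simp only [hA]
    ring
  have hlap2 : ∀ x, lap (fun y => u y * η y ^ (2 * n + 4)) x =
      η x ^ (2 * n + 4) * w x + 2 * η x ^ (n + 2) * A x + 2 * u x * G x := fun x => by
    have e : (fun y => η y ^ (2 * n + 4)) = fun y => η y ^ (n + 2) * η y ^ (n + 2) := by
      ext y
      ring
    rw [lap_mul hu2 hψ2, e, lap_mul hψ hψ, gradDot_comm u, gradDot_mul hψ hψ,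
      gradDot_comm (fun y => η y ^ (n + 2)) u]
    simp only [hA]
    ring
  have iX := hci (fun x => u x ^ (p + 1)) (2 * n + 4) hup (by omega)
  have iY := hci (fun x => w x ^ 2) (2 * n + 4) (hw2.continuous.pow 2) (by omega)
  have iS := hci (fun x => D * (u x * |w x|)) (2 * n + 2)
    (continuous_const.mul (hu2.continuous.mul hw2.continuous.abs)) (by omega)
  have iT := hci (fun x => D * gradDot u u x) (2 * n + 2) (continuous_const.mul hgc) (by omega)
  have iQ := hci (fun x => D ^ 2 * u x ^ 2) (2 * n)
    (continuous_const.mul (hu2.continuous.pow 2)) (by omega)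
  have iPA : Integrable fun x => A x ^ 2 := (hAc.pow 2).integrable_of_eq_zero hηc
    fun x hx => by simp [hA0 x hx]
  have iB : Integrable fun x => w x * η x ^ (n + 2) * A x :=
    ((hw2.continuous.mul hψ.continuous).mul hAc).integrable_of_eq_zero hηc
      fun x hx => by simp [hA0 x hx]
  have iG : Integrable fun x => u x * w x * G x :=
    ((hu2.continuous.mul hw2.continuous).mul hGc).integrable_of_eq_zero hηc
      fun x hx => by simp [hGz x hx]
  have hE : ∫ x, u x ^ (p + 1) * η x ^ (2 * n + 4) =
      (∫ x, w x ^ 2 * η x ^ (2 * n + 4)) + 2 * (∫ x, w x * η x ^ (n + 2) * A x) +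
        2 * ∫ x, u x * w x * G x := by
    have := integral_mul_lap_comm hw2 (hu2.mul hψ2) (hpc (2 * n + 4) (by omega)).mul_left
    simp_rw [hlap2, hpde] at this
    rw [← integral_const_mul, ← integral_const_mul, ← integral_add iY (iB.const_mul 2),
      ← integral_add _ (iG.const_mul 2)]
    · convert this.symm using 1
      · congr 1
        ext x
        rw [rpow_add (hu0 x), rpow_one]
        ring
      · congr 1
        ext x
        ring
    · exact iY.add (iB.const_mul 2)
  have hGS : |∫ x, u x * w x * G x| ≤ M * ∫ x, D * (u x * |w x|) * η x ^ (2 * n + 2) := by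
    rw [← integral_const_mul]
    refine (abs_integral_le_integral_abs).trans (integral_mono iG.abs (iS.const_mul M) fun x => ?_)
    show |u x * w x * G x| ≤ _
    rw [abs_mul, abs_mul, abs_of_pos (hu0 x), abs_of_nonneg (hG0 x)]
    have := mul_le_mul_of_nonneg_left (hGle x) (mul_nonneg (hu0 x).le (abs_nonneg (w x)))
    linarith
  have hGS' := abs_le.1 hGS
  refine add_le_of_energy_inequalities (PA := ∫ x, A x ^ 2)
    (S := ∫ x, D * (u x * |w x|) * η x ^ (2 * n + 2))
    (T := ∫ x, D * gradDot u u x * η x ^ (2 * n + 2)) hp hM1 ?_ ?_ ?_ ?_ ?_ ?_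
  · have := hstab _ (hu2.mul hψ) (hpc (n + 2) (by omega)).mul_left
    simp_rw [hlap1] at this
    have e1 : ∫ x, p * u x ^ (p - 1) * (u x * η x ^ (n + 2)) ^ 2 =
        p * ∫ x, u x ^ (p + 1) * η x ^ (2 * n + 4) := by
      rw [← integral_const_mul]
      congr 1
      ext x
      rw [show p + 1 = (p - 1) + 2 by ring, rpow_add (hu0 x), rpow_two]
      ring
    have e2 : ∫ x, (η x ^ (n + 2) * w x + A x) ^ 2 =
        (∫ x, w x ^ 2 * η x ^ (2 * n + 4)) + 2 * (∫ x, w x * η x ^ (n + 2) * A x) +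
          ∫ x, A x ^ 2 := by
      rw [← integral_const_mul, ← integral_add iY (iB.const_mul 2), ← integral_add _ iPA]
      · congr 1
        ext x
        ring
      · exact iY.add (iB.const_mul 2)
    rw [e1, e2] at this
    linarith
  · have hB : -(∫ x, w x * η x ^ (n + 2) * A x) ≤
        1 / 4 * (∫ x, w x ^ 2 * η x ^ (2 * n + 4)) + ∫ x, A x ^ 2 := by
      rw [← integral_neg, ← integral_const_mul, ← integral_add (iY.const_mul _) iPA]
      refine integral_mono iB.neg ((iY.const_mul _).add iPA) fun x => ?_
      have e : w x ^ 2 * η x ^ (2 * n + 4) = (w x * η x ^ (n + 2)) ^ 2 := by ring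
      show -(w x * η x ^ (n + 2) * A x) ≤ 1 / 4 * (w x ^ 2 * η x ^ (2 * n + 4)) + A x ^ 2
      rw [e]
      nlinarith [sq_nonneg (w x * η x ^ (n + 2) / 2 + A x)]
    linarith
  · rw [← integral_const_mul, ← integral_const_mul,
      ← integral_add (iT.const_mul _) (iQ.const_mul _)]
    exact integral_mono iPA ((iT.const_mul _).add (iQ.const_mul _)) hAle
  · have := integral_mul_lap_comm (hu2.pow 2) hgg (hpc (2 * n + 2) (by omega))
    have e1 : ∫ x, lap (fun y => u y ^ 2) x * η x ^ (2 * n + 2) =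
        2 * (∫ x, u x * w x * η x ^ (2 * n + 2)) +
          2 * ∫ x, gradDot u u x * η x ^ (2 * n + 2) := by
      rw [← integral_const_mul, ← integral_const_mul, ← integral_add
        ((hci (fun x => u x * w x) _ (hu2.continuous.mul hw2.continuous) (by omega)).const_mul 2)
        ((hci _ _ hgc (by omega)).const_mul 2)]
      congr 1
      ext x
      rw [lap_pow hu2]
      norm_num
      ring
    rw [e1] at this
    have e2 : ∫ x, D * gradDot u u x * η x ^ (2 * n + 2) =
        D * ∫ x, gradDot u u x * η x ^ (2 * n + 2) := by
      rw [← integral_const_mul]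
      congr 1
      ext x
      ring
    have e3 : ∫ x, D * (u x ^ 2 * lap (fun y => η y ^ (2 * n + 2)) x) ≤
        4 * M * ∫ x, D ^ 2 * u x ^ 2 * η x ^ (2 * n) := by
      rw [← integral_const_mul]
      refine integral_mono ?_ (iQ.const_mul _) fun x => ?_
      · refine (continuous_const.mul ((hu2.continuous.pow 2).mul
          hgg.continuous_lap)).integrable_of_eq_zero hηc fun x hx => ?_
        show D * (u x ^ 2 * lap (fun y => η y ^ (2 * n + 2)) x) = 0
        rw [lap_eq_zero (fun h' => hx (closure_mono (fun y hy => ?_) h')), mul_zero, mul_zero]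
        intro h0
        exact hy (by simp [h0])
      · have c := (le_abs_self _).trans
          (abs_lap_pow_le hη (hη0 x) (hη1 x) (hg x) (hl x) (2 * n))
        have c' : (((2 * n : ℕ) : ℝ) + 2) ^ 2 ≤ 4 * M := by
          rw [hM]
          push_cast
          nlinarith [(Nat.cast_nonneg n : (0 : ℝ) ≤ n)]
        have c2 : (((2 * n : ℕ) : ℝ) + 2) ^ 2 * D * η x ^ (2 * n) ≤ 4 * M * D * η x ^ (2 * n) := by
          have := hη0 x
          gcongr
        have := mul_le_mul_of_nonneg_left (c.trans c2) (mul_nonneg hD (sq_nonneg (u x)))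
        show D * (u x ^ 2 * lap (fun y => η y ^ (2 * n + 2)) x) ≤ _
        linarith
    rw [integral_const_mul, this] at e3
    have e4 : -(D * ∫ x, u x * w x * η x ^ (2 * n + 2)) ≤
        ∫ x, D * (u x * |w x|) * η x ^ (2 * n + 2) := by
      rw [← integral_const_mul, ← integral_neg]
      refine integral_mono (((hci (fun x => u x * w x) _
        (hu2.continuous.mul hw2.continuous) (by omega)).const_mul D).neg) iS fun x => ?_
      have : 0 ≤ D * u x * η x ^ (2 * n + 2) := by
        have := hη0 x
        have := (hu0 x).le
        positivity
      have := mul_le_mul_of_nonneg_left (neg_abs_le (w x)) this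
      show -(D * (u x * w x * η x ^ (2 * n + 2))) ≤ _
      linarith
    rw [e2]
    linarith
  · intro δ hδ
    rw [← integral_const_mul, ← integral_const_mul,
      ← integral_add (iY.const_mul _) (iQ.const_mul _)]
    refine integral_mono iS ((iY.const_mul _).add (iQ.const_mul _)) fun x => ?_
    have e1 : w x ^ 2 * η x ^ (2 * n + 4) = (|w x| * η x ^ (n + 2)) ^ 2 := by
      rw [mul_pow, sq_abs]
      ring
    have e2 : D ^ 2 * u x ^ 2 * η x ^ (2 * n) = (D * u x * η x ^ n) ^ 2 := by ring
    have e3 : D * (u x * |w x|) * η x ^ (2 * n + 2) =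
      (|w x| * η x ^ (n + 2)) * (D * u x * η x ^ n) := by ring
    show D * (u x * |w x|) * η x ^ (2 * n + 2) ≤ δ * (w x ^ 2 * η x ^ (2 * n + 4)) +
      1 / (4 * δ) * (D ^ 2 * u x ^ 2 * η x ^ (2 * n))
    rw [e1, e2, e3]
    generalize |w x| * η x ^ (n + 2) = a
    generalize D * u x * η x ^ n = b
    have : δ * a ^ 2 + 1 / (4 * δ) * b ^ 2 - a * b = (2 * δ * a - b) ^ 2 / (4 * δ) := by
      field_simp
      ring
    have h0 : 0 ≤ (2 * δ * a - b) ^ 2 / (4 * δ) := by positivity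
    linarith
  · exact integral_nonneg fun x => mul_nonneg (rpow_nonneg (hu0 x).le _) (pow_nonneg (hη0 x) _)

/-- Stable solutions have energy of order at most `R ^ (N - 4)` in balls of radius `R`. -/
lemma exists_integral_energy_le {p : ℝ} (hp : 1 < p) {u : EuclideanSpace ℝ (Fin N) → ℝ}
    (hu : ContDiff ℝ 4 u) (hu0 : ∀ x, 0 < u x) (hpde : ∀ x, lap (lap u) x = u x ^ p)
    (hstab : ∀ φ : EuclideanSpace ℝ (Fin N) → ℝ, ContDiff ℝ 2 φ → HasCompactSupport φ →
      ∫ x, p * u x ^ (p - 1) * φ x ^ 2 ≤ ∫ x, lap φ x ^ 2) :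
    ∃ C R₀ : ℝ, 0 < C ∧ 0 < R₀ ∧ ∀ R, R₀ ≤ R →
      ∫ x in Metric.closedBall 0 R, (u x ^ (p + 1) + lap u x ^ 2) ≤ C * R ^ N / R ^ 4 := by
  obtain ⟨C₀, hC₀, hcut⟩ := exists_cutoff N
  obtain ⟨n, hn⟩ := exists_nat_ge (4 / (p - 1))
  have hp' : 0 < p - 1 := by linarith
  have hn4 : 4 ≤ n * (p - 1) := (div_le_iff₀ hp').1 hn
  have hn0 : n ≠ 0 := by
    rintro rfl
    norm_num at hn4
  set κ : ℝ := (30 * ((n : ℝ) + 2) ^ 2 / (p - 1) + 36 * ((n : ℝ) + 2) ^ 2) ^ 2 +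
        2 * (54 * (((n : ℝ) + 2) ^ 2) ^ 2 / (p - 1) + 72 * (((n : ℝ) + 2) ^ 2) ^ 2) with hκ
  have hκ0 : 0 < κ := by positivity
  set ω := (volume (Metric.closedBall (0 : EuclideanSpace ℝ (Fin N)) 1)).toReal with hω
  have hω0 : 0 ≤ ω := ENNReal.toReal_nonneg
  have hu2 : ContDiff ℝ 2 u := hu.of_le (by norm_num)
  have hw2 : ContDiff ℝ 2 (lap u) := contDiff_lap hu (by norm_num)
  have hup : Continuous fun x => u x ^ (p + 1) := (hu2.rpow_of_pos hu0 _).continuous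
  refine ⟨2 * κ * C₀ ^ 2 * (ω + 1) * 2 ^ N, 1 + 2 * κ * C₀ ^ 2, by positivity, by positivity,
    fun R hR => ?_⟩
  have hR1 : 1 ≤ R := le_trans (by have : 0 ≤ 2 * κ * C₀ ^ 2 := by positivity
                                   linarith) hR
  have hR0 : 0 < R := by linarith
  obtain ⟨η, hη, hηc, hη0, hη1, hηR, hη2, hg, hl⟩ := hcut R hR0
  have hη' : ContDiff ℝ 2 η := contDiff_infty.1 hη 2
  have hmain := integral_energy_mul_pow_le hp hu hu0 hpde hstab hη' hηc hη0 hη1 hg hl hn0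
  rw [← hκ] at hmain
  set B := Metric.closedBall (0 : EuclideanSpace ℝ (Fin N)) (2 * R)
  have hB : IsCompact B := isCompact_closedBall _ _
  have hz : ∀ x ∉ B, η x = 0 := fun x hx => hη2 x (by
    have : 2 * R < ‖x‖ := by simpa [B] using hx
    exact this.le)
  have hci : ∀ (F : EuclideanSpace ℝ (Fin N) → ℝ) (k : ℕ), Continuous F → k ≠ 0 →
      Integrable fun x => F x * η x ^ k := fun F k hF hk =>
    (hF.mul (hη'.continuous.pow k)).integrable_of_eq_zero hB fun x hx => by simp [hz x hx, hk]
  have iX := hci (fun x => u x ^ (p + 1)) (2 * n + 4) hup (by omega)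
  have iY := hci (fun x => lap u x ^ 2) (2 * n + 4) (hw2.continuous.pow 2) (by omega)
  have iQ := hci (fun x => (C₀ / R ^ 2) ^ 2 * u x ^ 2) (2 * n)
    (continuous_const.mul (hu2.continuous.pow 2)) (by omega)
  have iB : Integrable (B.indicator fun _ => (1 : ℝ)) :=
    (integrable_indicator_iff hB.measurableSet).2 (integrableOn_const hB.measure_lt_top.ne)
  have hvol : ∫ x, B.indicator (fun _ => (1 : ℝ)) x = 2 ^ N * R ^ N * ω := by
    rw [integral_indicator hB.measurableSet, setIntegral_const, smul_eq_mul, mul_one,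
      measureReal_def, Measure.addHaar_closedBall _ _ (by positivity), ENNReal.toReal_mul,
      ENNReal.toReal_ofReal (by positivity), finrank_euclideanSpace_fin, mul_pow, hω,
      Measure.addHaar_closedBall _ _ zero_le_one]
    simp
  have hpt : ∀ x, (C₀ / R ^ 2) ^ 2 * u x ^ 2 * η x ^ (2 * n) ≤
      (C₀ / R ^ 2) ^ 2 *
        (u x ^ (p + 1) * η x ^ (2 * n + 4) + B.indicator (fun _ => (1 : ℝ)) x) := by
    intro x
    rw [mul_assoc]
    refine mul_le_mul_of_nonneg_left ?_ (sq_nonneg _)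
    by_cases hx : x ∈ B
    · rw [Set.indicator_of_mem hx]
      have hX : 0 ≤ u x ^ (p + 1) * η x ^ (2 * n + 4) :=
        mul_nonneg (rpow_nonneg (hu0 x).le _) (pow_nonneg (hη0 x) _)
      by_cases h1 : u x * η x ^ n ≤ 1
      · have : (u x * η x ^ n) ^ 2 ≤ 1 :=
          pow_le_one₀ (mul_nonneg (hu0 x).le (pow_nonneg (hη0 x) _)) h1
        have e : u x ^ 2 * η x ^ (2 * n) = (u x * η x ^ n) ^ 2 := by ring
        linarith
      · push Not at h1
        have hηp : 0 < η x := by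
          refine (hη0 x).lt_of_ne' fun h0 => ?_
          rw [h0, zero_pow hn0] at h1
          linarith
        have h2 : 1 ≤ (u x * η x ^ n) ^ (p - 1) := one_le_rpow h1.le hp'.le
        rw [mul_rpow (hu0 x).le (by positivity), ← rpow_natCast, ← rpow_mul hηp.le] at h2
        have h3 : η x ^ (n * (p - 1)) ≤ η x ^ 4 := by
          rw [← rpow_natCast (η x) 4]
          exact rpow_le_rpow_of_exponent_ge hηp (hη1 x) (by norm_num; exact hn4)
        have h4 : 1 ≤ u x ^ (p - 1) * η x ^ 4 :=
          h2.trans (mul_le_mul_of_nonneg_left h3 (rpow_nonneg (hu0 x).le _))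
        have e : u x ^ (p + 1) * η x ^ (2 * n + 4) =
            (u x ^ 2 * η x ^ (2 * n)) * (u x ^ (p - 1) * η x ^ 4) := by
          rw [show p + 1 = (p - 1) + 2 by ring, rpow_add (hu0 x), rpow_two]
          ring
        rw [e]
        have := mul_le_mul_of_nonneg_left h4 (by positivity : 0 ≤ u x ^ 2 * η x ^ (2 * n))
        linarith
    · rw [hz x hx, Set.indicator_of_notMem hx]
      simp [hn0]
  have hQ := integral_mono iQ ((iX.add iB).const_mul _) hpt
  have hQ' : ∫ x, (C₀ / R ^ 2) ^ 2 * (u x ^ (p + 1) * η x ^ (2 * n + 4) +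
      B.indicator (fun _ => (1 : ℝ)) x) =
      (C₀ / R ^ 2) ^ 2 * ((∫ x, u x ^ (p + 1) * η x ^ (2 * n + 4)) + 2 ^ N * R ^ N * ω) := by
    rw [integral_const_mul, integral_add iX iB, hvol]
  have hQ2 := hQ.trans_eq hQ'
  have hX0 : 0 ≤ ∫ x, u x ^ (p + 1) * η x ^ (2 * n + 4) :=
    integral_nonneg fun x => mul_nonneg (rpow_nonneg (hu0 x).le _) (pow_nonneg (hη0 x) _)
  have hY0 : 0 ≤ ∫ x, lap u x ^ 2 * η x ^ (2 * n + 4) :=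
    integral_nonneg fun x => mul_nonneg (sq_nonneg _) (pow_nonneg (hη0 x) _)
  have hsmall : κ * (C₀ / R ^ 2) ^ 2 ≤ 1 / 2 := by
    rw [div_pow, ← mul_div_assoc, div_le_div_iff₀ (by positivity) (by norm_num)]
    have : R ≤ (R ^ 2) ^ 2 := by
      rw [← pow_mul]
      exact le_self_pow₀ hR1 (by norm_num)
    linarith
  have h5 := mul_le_mul_of_nonneg_left hQ2 hκ0.le
  have h6 := mul_le_mul_of_nonneg_right hsmall hX0
  have hsum : (∫ x, u x ^ (p + 1) * η x ^ (2 * n + 4)) +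
      ∫ x, lap u x ^ 2 * η x ^ (2 * n + 4) ≤
      2 * (κ * (C₀ / R ^ 2) ^ 2 * (2 ^ N * R ^ N * ω)) := by
    linarith
  have hle : ∫ x in Metric.closedBall 0 R, (u x ^ (p + 1) + lap u x ^ 2) ≤
      (∫ x, u x ^ (p + 1) * η x ^ (2 * n + 4)) + ∫ x, lap u x ^ 2 * η x ^ (2 * n + 4) := by
    rw [← integral_add iX iY, ← integral_indicator Metric.isClosed_closedBall.measurableSet]
    refine integral_mono ?_ (iX.add iY) fun x => ?_
    · exact ((hup.add (hw2.continuous.pow 2)).continuousOn.integrableOn_compact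
        (isCompact_closedBall _ _)).integrable_indicator Metric.isClosed_closedBall.measurableSet
    · show _ ≤ u x ^ (p + 1) * η x ^ (2 * n + 4) + lap u x ^ 2 * η x ^ (2 * n + 4)
      by_cases hx : x ∈ Metric.closedBall (0 : EuclideanSpace ℝ (Fin N)) R
      · rw [Set.indicator_of_mem hx, hηR x (by simpa using hx)]
        simp
      · rw [Set.indicator_of_notMem hx]
        exact add_nonneg (mul_nonneg (rpow_nonneg (hu0 x).le _) (pow_nonneg (hη0 x) _))
          (mul_nonneg (sq_nonneg _) (pow_nonneg (hη0 x) _))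
  refine (hle.trans hsum).trans ?_
  have e1 : 2 * (κ * (C₀ / R ^ 2) ^ 2 * (2 ^ N * R ^ N * ω)) =
      2 * κ * C₀ ^ 2 * ω * 2 ^ N * R ^ N / R ^ 4 := by
    field_simp
  rw [e1]
  gcongr
  linarith

end Energy

section Liouville

variable {N : ℕ} {f g : EuclideanSpace ℝ (Fin N) → ℝ}

lemma lap_congr {x : EuclideanSpace ℝ (Fin N)} (h : f =ᶠ[nhds x] g) : lap f x = lap g x := by
  unfold lap
  refine Finset.sum_congr rfl fun i _ => ?_
  have : (fun y => fderiv ℝ f y (EuclideanSpace.single i 1)) =ᶠ[nhds x]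
      fun y => fderiv ℝ g y (EuclideanSpace.single i 1) :=
    (h.fderiv (𝕜 := ℝ)).mono fun y hy => by simp only [hy]
  rw [this.fderiv_eq]

lemma gradDot_congr {h : EuclideanSpace ℝ (Fin N) → ℝ} {x : EuclideanSpace ℝ (Fin N)}
    (hfg : f =ᶠ[nhds x] g) : gradDot f h x = gradDot g h x := by
  unfold gradDot
  rw [hfg.fderiv_eq]

lemma lap_const (c : ℝ) (x : EuclideanSpace ℝ (Fin N)) : lap (fun _ => c) x = 0 := by
  simp [lap]

lemma gradDot_const (c : ℝ) (h : EuclideanSpace ℝ (Fin N) → ℝ) (x : EuclideanSpace ℝ (Fin N)) :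
    gradDot (fun _ => c) h x = 0 := by
  simp [gradDot]

lemma contDiff_one_add_norm_sq {n : WithTop ℕ∞} :
    ContDiff ℝ n fun y : EuclideanSpace ℝ (Fin N) => 1 + ‖y‖ ^ 2 :=
  contDiff_const.add (contDiff_norm_sq ℝ)

lemma partial_one_add_norm_sq (i : Fin N) (x : EuclideanSpace ℝ (Fin N)) :
    fderiv ℝ (fun y : EuclideanSpace ℝ (Fin N) => 1 + ‖y‖ ^ 2) x (EuclideanSpace.single i 1) =
      2 * x i := by
  rw [fderiv_const_add, ((hasStrictFDerivAt_norm_sq x).hasFDerivAt).fderiv]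
  simp [EuclideanSpace.inner_single_right]

lemma lap_one_add_norm_sq (x : EuclideanSpace ℝ (Fin N)) :
    lap (fun y : EuclideanSpace ℝ (Fin N) => 1 + ‖y‖ ^ 2) x = 2 * N := by
  unfold lap
  simp_rw [partial_one_add_norm_sq]
  have : ∀ i : Fin N, fderiv ℝ (fun y : EuclideanSpace ℝ (Fin N) => 2 * y i) x
      (EuclideanSpace.single i 1) = 2 := fun i => by
    have h : HasFDerivAt (fun y : EuclideanSpace ℝ (Fin N) => 2 * y i)
        ((2 : ℝ) • (EuclideanSpace.proj i : EuclideanSpace ℝ (Fin N) →L[ℝ] ℝ)) x :=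
      ((EuclideanSpace.proj i : EuclideanSpace ℝ (Fin N) →L[ℝ] ℝ).hasFDerivAt).const_mul 2
    rw [h.fderiv]
    simp
  simp_rw [this]
  simp [mul_comm]

lemma gradDot_one_add_norm_sq (x : EuclideanSpace ℝ (Fin N)) :
    gradDot (fun y : EuclideanSpace ℝ (Fin N) => 1 + ‖y‖ ^ 2) (fun y => 1 + ‖y‖ ^ 2) x =
      4 * ‖x‖ ^ 2 := by
  unfold gradDot
  simp_rw [partial_one_add_norm_sq]
  rw [EuclideanSpace.real_norm_sq_eq, Finset.mul_sum]
  exact Finset.sum_congr rfl fun i _ => by ring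

/-- A nonnegative subharmonic function whose integrals over balls grow like `R ^ (N - 4)`
vanishes identically. -/
lemma eq_zero_of_lap_nonneg (hN : 3 ≤ N) {F : EuclideanSpace ℝ (Fin N) → ℝ} (hF : ContDiff ℝ 2 F)
    (hF0 : ∀ x, 0 ≤ F x) (hlap : ∀ x, 0 ≤ lap F x) {C R₀ : ℝ}
    (hgrowth : ∀ R, R₀ ≤ R → ∫ x in Metric.closedBall 0 R, F x ≤ C * R ^ N / R ^ 4)
    (x : EuclideanSpace ℝ (Fin N)) : F x = 0 := by
  obtain ⟨C₀, hC₀, hcut⟩ := exists_cutoff N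
  set α : ℝ := ((N : ℝ) - 2) / 2 with hα
  have hN' : (3 : ℝ) ≤ N := by exact_mod_cast hN
  have hα0 : 0 < α := by rw [hα]; linarith
  set ρ : EuclideanSpace ℝ (Fin N) → ℝ := fun y => 1 + ‖y‖ ^ 2 with hρdef
  have hρ : ContDiff ℝ 2 ρ := contDiff_one_add_norm_sq
  have hρ1 : ∀ y, 1 ≤ ρ y := fun y => by simp only [hρdef]; nlinarith [sq_nonneg ‖y‖]
  have hρ0 : ∀ y, 0 < ρ y := fun y => by linarith [hρ1 y]
  have hH : ContDiff ℝ 2 fun y => ρ y ^ (-α) := hρ.rpow_of_pos hρ0 _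
  set k : EuclideanSpace ℝ (Fin N) → ℝ := fun y => 2 * α * N * ρ y ^ (-α - 2) with hk
  have hkc : Continuous k := continuous_const.mul (hρ.rpow_of_pos hρ0 _).continuous
  have hk0 : ∀ y, 0 < k y := fun y => by
    have := rpow_pos_of_pos (hρ0 y) (-α - 2)
    positivity
  have hlapH : ∀ y, lap (fun y => ρ y ^ (-α)) y = -k y := fun y => by
    rw [lap_rpow hρ hρ0, lap_one_add_norm_sq, gradDot_one_add_norm_sq,
      show ‖y‖ ^ 2 = ρ y - 1 by simp [hρdef], show -α - 1 = (-α - 2) + 1 by ring,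
      rpow_add (hρ0 y), rpow_one]
    simp only [hk, hα]
    ring
  have hHle : ∀ R > 0, ∀ y, R ≤ ‖y‖ → ρ y ^ (-α) ≤ R ^ 2 / R ^ N := fun R hR y hy => by
    have h1 : R ^ 2 ≤ ρ y := by
      have := pow_le_pow_left₀ hR.le hy 2
      simp only [hρdef]
      linarith
    have h2 := rpow_le_rpow_of_nonpos (by positivity : 0 < R ^ 2) h1 (by linarith : -α ≤ 0)
    refine h2.trans (le_of_eq ?_)
    rw [← rpow_natCast R 2, ← rpow_mul hR.le, ← rpow_natCast R N, ← rpow_sub hR, hα]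
    congr 1
    push_cast
    ring
  have hGle : ∀ R > 0, ∀ y, R ≤ ‖y‖ →
      gradDot (fun y => ρ y ^ (-α)) (fun y => ρ y ^ (-α)) y ≤
        4 * α ^ 2 * (R / R ^ N) ^ 2 := fun R hR y hy => by
    have h1 : R ^ 2 ≤ ρ y := by
      have := pow_le_pow_left₀ hR.le hy 2
      simp only [hρdef]
      linarith
    rw [gradDot_comp (φ := fun t => t ^ (-α)) (φ' := fun t => -α * t ^ (-α - 1)) hρ y
        (Real.hasDerivAt_rpow_const (Or.inl (hρ0 y).ne')), gradDot_comm,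
      gradDot_comp (φ := fun t => t ^ (-α)) (φ' := fun t => -α * t ^ (-α - 1)) hρ y
        (Real.hasDerivAt_rpow_const (Or.inl (hρ0 y).ne')), gradDot_one_add_norm_sq,
      show ‖y‖ ^ 2 = ρ y - 1 by simp [hρdef]]
    have e : ρ y ^ (-2 * α - 1) = ρ y ^ (-α - 1) * ρ y ^ (-α - 1) * ρ y := by
      rw [← rpow_add (hρ0 y), ← rpow_add_one (hρ0 y).ne']
      congr 1
      ring
    have h2 := rpow_le_rpow_of_nonpos (by positivity : 0 < R ^ 2) h1
      (by linarith : -2 * α - 1 ≤ 0)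
    have e2 : (R ^ 2) ^ (-2 * α - 1) = (R / R ^ N) ^ 2 := by
      rw [← rpow_natCast R 2, ← rpow_mul hR.le, ← rpow_natCast R N]
      nth_rewrite 2 [← rpow_one R]
      rw [← rpow_sub hR, ← rpow_natCast _ 2, ← rpow_mul hR.le, hα]
      congr 1
      push_cast
      ring
    have h3 : 0 ≤ ρ y ^ (-α - 1) * ρ y ^ (-α - 1) := mul_self_nonneg _
    have h4 := mul_le_mul_of_nonneg_left (e ▸ e2 ▸ h2) (by positivity : 0 ≤ 4 * α ^ 2)
    have h5 := mul_nonneg (by positivity : 0 ≤ 4 * α ^ 2) h3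
    linarith
  set E : ℝ := C₀ + 4 * α * (1 + C₀) with hE
  have hE0 : 0 < E := by positivity
  have hbound : ∀ R, max R₀ 1 ≤ R → ∀ η : EuclideanSpace ℝ (Fin N) → ℝ, ContDiff ℝ 2 η →
      HasCompactSupport η → (∀ x, 0 ≤ η x) → (∀ x, ‖x‖ ≤ R → η x = 1) →
      (∀ x, 2 * R ≤ ‖x‖ → η x = 0) → (∀ x, gradDot η η x ≤ C₀ / R ^ 2) →
      (∀ x, |lap η x| ≤ C₀ / R ^ 2) →
      ∫ y, F y * k y * η y ≤ E * C * 2 ^ N / 16 / R ^ 4 := by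
    intro R hRm η hη hηc hη0 hηR hη2 hg hl
    have hR1 : 1 ≤ R := (le_max_right _ _).trans hRm
    have hR : 0 < R := by linarith
    have hRN : 0 < R ^ N := by positivity
    set B := Metric.closedBall (0 : EuclideanSpace ℝ (Fin N)) (2 * R) with hB
    have hBc : IsCompact B := isCompact_closedBall _ _
    have hBm : MeasurableSet B := hBc.measurableSet
    have hz : ∀ y ∉ B, η y = 0 := fun y hy => hη2 y (by
      have : 2 * R < ‖y‖ := by simpa [B] using hy
      exact this.le)
    have hts : tsupport η ⊆ B := closure_minimal (fun y hy => by
      by_contra h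
      exact hy (hz y h)) hBc.isClosed
    have hpt : ∀ y, F y * lap (fun y => ρ y ^ (-α) * η y) y ≤
        -(F y * k y * η y) + E / R ^ N * B.indicator F y := by
      intro y
      rw [lap_mul hH hη, hlapH]
      have hmain : ρ y ^ (-α) * lap η y + 2 * gradDot (fun y => ρ y ^ (-α)) η y ≤
          E / R ^ N * B.indicator (fun _ => 1) y := by
        by_cases hy : y ∈ B
        · rw [Set.indicator_of_mem hy, mul_one]
          rcases lt_or_ge ‖y‖ R with h | h
          · have hev : η =ᶠ[nhds y] fun _ => 1 := by
              filter_upwards [(isOpen_lt continuous_norm continuous_const).mem_nhds h] with z hz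
              exact hηR z (le_of_lt hz)
            rw [lap_congr hev, lap_const, gradDot_comm, gradDot_congr hev, gradDot_const]
            simp only [mul_zero, add_zero]
            positivity
          · have h1 : ρ y ^ (-α) * lap η y ≤ C₀ / R ^ N := by
              have := mul_le_mul (hHle R hR y h) (hl y) (abs_nonneg _) (by positivity)
              have h' := mul_le_mul_of_nonneg_left (le_abs_self (lap η y))
                (rpow_nonneg (hρ0 y).le (-α))
              refine (h'.trans this).trans (le_of_eq ?_)
              field_simp
            have h2 : gradDot (fun y => ρ y ^ (-α)) η y ≤ 2 * α * (1 + C₀) / R ^ N := by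
              refine le_of_sq_le_sq ?_ (by positivity)
              refine (gradDot_sq_le _ _ _).trans ?_
              refine (mul_le_mul (hGle R hR y h) (hg y) (gradDot_self_nonneg _ _)
                (by positivity)).trans ?_
              have e : 4 * α ^ 2 * (R / R ^ N) ^ 2 * (C₀ / R ^ 2) =
                  (2 * α / R ^ N) ^ 2 * C₀ := by
                field_simp
                norm_num
              have e' : (2 * α * (1 + C₀) / R ^ N) ^ 2 = (2 * α / R ^ N) ^ 2 * (1 + C₀) ^ 2 := by
                ring
              rw [e, e']
              gcongr
              nlinarith
            have e : E / R ^ N = C₀ / R ^ N + 2 * (2 * α * (1 + C₀) / R ^ N) := by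
              rw [hE]
              ring
            linarith
        · have hy' : y ∉ tsupport η := fun h' => hy (hts h')
          rw [Set.indicator_of_notMem hy, lap_eq_zero hy', gradDot_eq_zero hy']
          simp
      have := mul_le_mul_of_nonneg_left hmain (hF0 y)
      have e : F y * B.indicator (fun _ => 1) y = B.indicator F y := by
        by_cases hy : y ∈ B
        · simp [hy]
        · simp [hy]
      rw [← e]
      linarith
    have i1 : Integrable fun y => F y * k y * η y :=
      ((hF.continuous.mul hkc).mul hη.continuous).integrable_of_eq_zero hBc
        fun y hy => by simp [hz y hy]
    have i2 : Integrable (B.indicator F) :=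
      (hF.continuous.continuousOn.integrableOn_compact hBc).integrable_indicator hBm
    have i3 : Integrable fun y => F y * lap (fun y => ρ y ^ (-α) * η y) y :=
      (hF.continuous.mul (hH.mul hη).continuous_lap).integrable_of_hasCompactSupport
        (hηc.mul_left (f := fun y => ρ y ^ (-α))).lap.mul_left
    have h1 := integral_mono i3 (i1.neg.add (i2.const_mul (E / R ^ N))) hpt
    have h2 : ∫ y, (-(F y * k y * η y) + E / R ^ N * B.indicator F y) =
        -(∫ y, F y * k y * η y) + E / R ^ N * ∫ y in B, F y := by
      have i1' : Integrable fun y => -(F y * k y * η y) := i1.neg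
      rw [integral_add i1' (i2.const_mul _), integral_neg, integral_const_mul,
        integral_indicator hBm]
    have h3 := h1.trans_eq h2
    rw [integral_mul_lap_comm hF (hH.mul hη) hηc.mul_left] at h3
    have h4 : 0 ≤ ∫ y, lap F y * (ρ y ^ (-α) * η y) := integral_nonneg fun y =>
      mul_nonneg (hlap y) (mul_nonneg (rpow_nonneg (hρ0 y).le _) (hη0 y))
    have h5 := hgrowth (2 * R) (((le_max_left _ _).trans hRm).trans (by linarith))
    have h6 := mul_le_mul_of_nonneg_left h5 (by positivity : 0 ≤ E / R ^ N)
    have h7 : E / R ^ N * (C * (2 * R) ^ N / (2 * R) ^ 4) = E * C * 2 ^ N / 16 / R ^ 4 := by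
      rw [mul_pow, mul_pow]
      field_simp
      norm_num
    linarith
  set R₁ := max (max R₀ 1) ‖x‖ with hR₁
  have hR₁1 : 1 ≤ R₁ := (le_max_right _ _).trans (le_max_left _ _)
  obtain ⟨η₁, hη₁, hη₁c, hη₁0, hη₁1, hη₁R, hη₁2, -, -⟩ := hcut R₁ (by linarith)
  have hη₁' : ContDiff ℝ 2 η₁ := contDiff_infty.1 hη₁ 2
  by_contra hx
  have hpos : 0 < ∫ y, F y * k y * η₁ y := by
    refine Continuous.integral_pos_of_hasCompactSupport_nonneg_nonzero (x := x)
      ((hF.continuous.mul hkc).mul hη₁'.continuous) hη₁c.mul_left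
      (fun y => mul_nonneg (mul_nonneg (hF0 y) (hk0 y).le) (hη₁0 y)) ?_
    rw [hη₁R x (le_max_right _ _), mul_one]
    exact mul_ne_zero hx (hk0 x).ne'
  have hle : ∀ᶠ R : ℝ in Filter.atTop, ∫ y, F y * k y * η₁ y ≤ E * C * 2 ^ N / 16 / R ^ 4 := by
    filter_upwards [Filter.eventually_ge_atTop (2 * R₁)] with R hR
    obtain ⟨η, hη, hηc, hη0, hη1, hηR, hη2, hg, hl⟩ := hcut R (by linarith)
    have hη' : ContDiff ℝ 2 η := contDiff_infty.1 hη 2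
    refine le_trans ?_ (hbound R ((le_max_left _ ‖x‖).trans (by linarith)) η hη' hηc hη0 hηR hη2
      hg hl)
    refine integral_mono
      (((hF.continuous.mul hkc).mul hη₁'.continuous).integrable_of_hasCompactSupport
        hη₁c.mul_left)
      (((hF.continuous.mul hkc).mul hη'.continuous).integrable_of_hasCompactSupport
        hηc.mul_left) fun y => ?_
    refine mul_le_mul_of_nonneg_left ?_ (mul_nonneg (hF0 y) (hk0 y).le)
    rcases le_total ‖y‖ R with h | h
    · rw [hηR y h]
      exact hη₁1 y
    · rw [hη₁2 y (by linarith)]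
      exact hη0 y
  have hlim : Filter.Tendsto (fun R : ℝ => E * C * 2 ^ N / 16 / R ^ 4) Filter.atTop (nhds 0) :=
    tendsto_const_nhds.div_atTop (Filter.tendsto_pow_atTop (by norm_num))
  exact absurd (ge_of_tendsto hlim hle) (not_le.2 hpos)

end Liouville

section PointwiseBound

variable {N : ℕ}

/-- A convex `C²` truncation with quadratic growth. -/
noncomputable def truncQuad (t : ℝ) : ℝ := max t 0 ^ 4 / (1 + t ^ 2)

/-- The derivative of `truncQuad`. -/
noncomputable def truncQuadDeriv (t : ℝ) : ℝ :=
  (4 * max t 0 ^ 3 + 2 * max t 0 ^ 5) / (1 + t ^ 2) ^ 2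

/-- The second derivative of `truncQuad`. -/
noncomputable def truncQuadDeriv₂ (t : ℝ) : ℝ :=
  (12 * max t 0 ^ 2 + 6 * max t 0 ^ 4 + 2 * max t 0 ^ 6) / (1 + t ^ 2) ^ 3

lemma hasDerivAt_max_zero_pow (n : ℕ) (t : ℝ) :
    HasDerivAt (fun t : ℝ => max t 0 ^ (n + 2)) ((n + 2) * max t 0 ^ (n + 1)) t := by
  rcases lt_trichotomy t 0 with h | rfl | h
  · have he : (fun t : ℝ => max t 0 ^ (n + 2)) =ᶠ[nhds t] fun _ => 0 := by
      filter_upwards [Iio_mem_nhds h] with y hy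
      rw [max_eq_right (le_of_lt hy)]
      simp
    rw [max_eq_right h.le]
    simpa using (hasDerivAt_const t (0 : ℝ)).congr_of_eventuallyEq he
  · rw [hasDerivAt_iff_isLittleO_nhds_zero]
    have h1 : (fun h : ℝ => max h 0 ^ (n + 2)) =O[nhds 0] fun h => h ^ 2 := by
      refine Asymptotics.IsBigO.of_bound 1 ?_
      filter_upwards [Metric.ball_mem_nhds (0 : ℝ) one_pos] with h hh
      have hh1 : |h| < 1 := by simpa using hh
      have hm : max h 0 ≤ |h| := max_le (le_abs_self h) (abs_nonneg h)
      have hm0 : 0 ≤ max h 0 := le_max_right _ _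
      rw [Real.norm_of_nonneg (by positivity), Real.norm_of_nonneg (by positivity), one_mul,
        ← sq_abs h]
      calc max h 0 ^ (n + 2) ≤ |h| ^ (n + 2) := by gcongr
        _ ≤ |h| ^ 2 := pow_le_pow_of_le_one (abs_nonneg h) hh1.le (by omega)
    have h2 : (fun h : ℝ => h ^ 2) =o[nhds 0] fun h => h := by
      simpa using Asymptotics.isLittleO_pow_pow (𝕜 := ℝ) (m := 1) (n := 2) (by norm_num)
    simpa using h1.trans_isLittleO h2
  · have he : (fun t : ℝ => max t 0 ^ (n + 2)) =ᶠ[nhds t] fun t => t ^ (n + 2) := by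
      filter_upwards [Ioi_mem_nhds h] with y hy
      rw [max_eq_left (le_of_lt hy)]
    rw [max_eq_left h.le]
    simpa using (hasDerivAt_pow (n + 2) t).congr_of_eventuallyEq he

lemma hasDerivAt_truncQuad (t : ℝ) : HasDerivAt truncQuad (truncQuadDeriv t) t := by
  have h0 : (1 + t ^ 2) ≠ 0 := by positivity
  have h1 := hasDerivAt_max_zero_pow 2 t
  have h2 : HasDerivAt (fun t : ℝ => 1 + t ^ 2) (2 * t) t := by
    simpa using (hasDerivAt_pow 2 t).const_add 1
  refine (h1.div h2 h0).congr_deriv ?_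
  unfold truncQuadDeriv
  norm_num
  congr 1
  rcases le_total t 0 with h | h
  · simp [h]
  · simp only [h, max_eq_left]
    ring

lemma hasDerivAt_truncQuadDeriv (t : ℝ) :
    HasDerivAt truncQuadDeriv (truncQuadDeriv₂ t) t := by
  have h0 : (1 + t ^ 2) ^ 2 ≠ 0 := by positivity
  have h1 := ((hasDerivAt_max_zero_pow 1 t).const_mul 4).add
    ((hasDerivAt_max_zero_pow 3 t).const_mul 2)
  have h2 : HasDerivAt (fun t : ℝ => (1 + t ^ 2) ^ 2) (2 * (1 + t ^ 2) * (2 * t)) t := by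
    have h3 : HasDerivAt (fun t : ℝ => 1 + t ^ 2) (2 * t) t := by
      simpa using (hasDerivAt_pow 2 t).const_add 1
    simpa using h3.fun_pow 2
  refine (h1.div h2 h0).congr_deriv ?_
  unfold truncQuadDeriv₂
  norm_num
  rw [div_eq_div_iff (by positivity) (by positivity)]
  rcases le_total t 0 with h | h
  · simp [h]
  · simp only [h, max_eq_left]
    ring

lemma truncQuad_nonneg (t : ℝ) : 0 ≤ truncQuad t := by
  have := le_max_right t 0
  unfold truncQuad
  positivity

lemma truncQuad_le_sq (t : ℝ) : truncQuad t ≤ t ^ 2 := by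
  unfold truncQuad
  rw [div_le_iff₀ (by positivity)]
  rcases le_total t 0 with h | h
  · have : 0 ≤ t ^ 2 * (1 + t ^ 2) := by positivity
    simpa [h] using this
  · simp only [h, max_eq_left]
    nlinarith [sq_nonneg t]

lemma truncQuadDeriv_nonneg (t : ℝ) : 0 ≤ truncQuadDeriv t := by
  have := le_max_right t 0
  unfold truncQuadDeriv
  positivity

lemma truncQuadDeriv_mul_self_nonneg (t : ℝ) : 0 ≤ truncQuadDeriv t * t := by
  rcases le_total t 0 with h | h
  · simp [truncQuadDeriv, h]
  · exact mul_nonneg (truncQuadDeriv_nonneg t) h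

lemma truncQuadDeriv₂_nonneg (t : ℝ) : 0 ≤ truncQuadDeriv₂ t := by
  have := le_max_right t 0
  unfold truncQuadDeriv₂
  positivity

lemma contDiff_truncQuad : ContDiff ℝ 2 truncQuad := by
  have hc : Continuous truncQuadDeriv₂ := by
    unfold truncQuadDeriv₂
    exact Continuous.div (by fun_prop) (by fun_prop) fun t => by positivity
  have h1 : ContDiff ℝ 1 truncQuadDeriv := by
    rw [contDiff_one_iff_deriv]
    refine ⟨fun t => (hasDerivAt_truncQuadDeriv t).differentiableAt, ?_⟩
    rwa [funext fun t => (hasDerivAt_truncQuadDeriv t).deriv]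
  rw [show (2 : WithTop ℕ∞) = 1 + 1 by norm_num, contDiff_succ_iff_deriv]
  refine ⟨fun t => (hasDerivAt_truncQuad t).differentiableAt, by simp, ?_⟩
  rwa [funext fun t => (hasDerivAt_truncQuad t).deriv]

/-- Souplet's pointwise comparison between a stable solution and its Laplacian. -/
lemma mul_rpow_le_neg_lap (hN : 3 ≤ N) {p : ℝ} (hp : 1 < p) {u : EuclideanSpace ℝ (Fin N) → ℝ}
    (hu : ContDiff ℝ 4 u) (hu0 : ∀ x, 0 < u x) (hpde : ∀ x, lap (lap u) x = u x ^ p)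
    (hstab : ∀ φ : EuclideanSpace ℝ (Fin N) → ℝ, ContDiff ℝ 2 φ → HasCompactSupport φ →
      ∫ x, p * u x ^ (p - 1) * φ x ^ 2 ≤ ∫ x, lap φ x ^ 2) (x : EuclideanSpace ℝ (Fin N)) :
    √(2 / (p + 1)) * u x ^ ((p + 1) / 2) ≤ -lap u x := by
  obtain ⟨C, R₀, hC, hR₀, hgrowth⟩ := exists_integral_energy_le hp hu hu0 hpde hstab
  set c := √(2 / (p + 1)) with hc
  have hc0 : 0 < c := Real.sqrt_pos.2 (by positivity)
  have hc2 : c ^ 2 = 2 / (p + 1) := Real.sq_sqrt (by positivity)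
  have hu2 : ContDiff ℝ 2 u := hu.of_le (by norm_num)
  have hw2 : ContDiff ℝ 2 (lap u) := contDiff_lap hu (by norm_num)
  have hq : ContDiff ℝ 2 fun y => u y ^ ((p + 1) / 2) := hu2.rpow_of_pos hu0 _
  set z : EuclideanSpace ℝ (Fin N) → ℝ := fun y => c * u y ^ ((p + 1) / 2) + lap u y with hz
  have hz2 : ContDiff ℝ 2 z := (contDiff_const.mul hq).add hw2
  have hlapz : ∀ y, 1 / c * u y ^ ((p - 1) / 2) * z y ≤ lap z y := fun y => by
    simp only [hz]
    rw [lap_add (contDiff_const.mul hq) hw2, lap_const_mul c hq, hpde, lap_rpow hu2 hu0]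
    have h1 : 0 ≤ (p + 1) / 2 * ((p + 1) / 2 - 1) * u y ^ ((p + 1) / 2 - 2) * gradDot u u y := by
      have h2 := rpow_nonneg (hu0 y).le ((p + 1) / 2 - 2)
      have h3 := gradDot_self_nonneg u y
      have h4 : 0 ≤ (p + 1) / 2 - 1 := by linarith
      positivity
    have h2 := mul_nonneg hc0.le h1
    have e1 : (p + 1) / 2 - 1 = (p - 1) / 2 := by ring
    have e2 : u y ^ p = u y ^ ((p - 1) / 2) * u y ^ ((p + 1) / 2) := by
      rw [← rpow_add (hu0 y)]
      ring_nf
    have e3 : c * ((p + 1) / 2) = 1 / c := by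
      rw [eq_div_iff hc0.ne']
      have : c * ((p + 1) / 2) * c = c ^ 2 * ((p + 1) / 2) := by ring
      rw [this, hc2]
      field_simp
    have e4 : 1 / c * u y ^ ((p - 1) / 2) * (c * u y ^ ((p + 1) / 2) + lap u y) =
        u y ^ p + c * ((p + 1) / 2) * u y ^ ((p - 1) / 2) * lap u y := by
      rw [e2, e3]
      field_simp
    rw [e4, e1] at *
    linarith
  have hF : ContDiff ℝ 2 fun y => truncQuad (z y) := contDiff_truncQuad.comp hz2
  have hzero := eq_zero_of_lap_nonneg hN hF (fun y => truncQuad_nonneg _) (fun y => by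
    rw [lap_comp hz2 (fun y => hasDerivAt_truncQuad _) (fun y => hasDerivAt_truncQuadDeriv _)]
    have h1 := mul_le_mul_of_nonneg_left (hlapz y) (truncQuadDeriv_nonneg (z y))
    have h2 := mul_nonneg (truncQuadDeriv₂_nonneg (z y)) (gradDot_self_nonneg z y)
    have h3 := mul_nonneg (mul_nonneg (by positivity : 0 ≤ 1 / c)
      (rpow_nonneg (hu0 y).le ((p - 1) / 2))) (truncQuadDeriv_mul_self_nonneg (z y))
    linarith) (C := 2 * C) (R₀ := R₀) (fun R hR => by
    have hK : IsCompact (Metric.closedBall (0 : EuclideanSpace ℝ (Fin N)) R) :=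
      isCompact_closedBall _ _
    have h1 : ∫ y in Metric.closedBall 0 R, truncQuad (z y) ≤
        ∫ y in Metric.closedBall 0 R, 2 * (u y ^ (p + 1) + lap u y ^ 2) := by
      refine setIntegral_mono (hF.continuous.continuousOn.integrableOn_compact hK)
        ((continuous_const.mul ((hu2.rpow_of_pos hu0 _).continuous.add
          (hw2.continuous.pow 2))).continuousOn.integrableOn_compact hK) fun y => ?_
      have h2 := truncQuad_le_sq (z y)
      have h3 := add_sq_le (a := c * u y ^ ((p + 1) / 2)) (b := lap u y)
      have e : (u y ^ ((p + 1) / 2)) ^ 2 = u y ^ (p + 1) := by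
        rw [← rpow_natCast, ← rpow_mul (hu0 y).le]
        norm_num
      rw [mul_pow, e, hc2] at h3
      have h4 : 2 / (p + 1) ≤ 1 := by
        rw [div_le_one (by linarith)]
        linarith
      have h5 := mul_le_mul_of_nonneg_right h4 (rpow_nonneg (hu0 y).le (p + 1))
      show truncQuad (z y) ≤ 2 * (u y ^ (p + 1) + lap u y ^ 2)
      linarith
    rw [integral_const_mul] at h1
    have h2 := hgrowth R hR
    have e : 2 * C * R ^ N / R ^ 4 = 2 * (C * R ^ N / R ^ 4) := by ring
    linarith)
  have hzx : z x ≤ 0 := by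
    by_contra! h
    have h1 := hzero x
    unfold truncQuad at h1
    rw [max_eq_left h.le] at h1
    have : 0 < z x ^ 4 / (1 + z x ^ 2) := by positivity
    linarith
  simp only [hz] at hzx
  linarith

end PointwiseBound

section Exponents

lemma Lpoly_neg {p s s₀ : ℝ} (hp : 1 < p) (hs : 2 ≤ s) (hss₀ : s < s₀) (h0 : Lpoly p s₀ = 0) :
    (p + 1) ^ 2 * s ^ 4 < 32 * p * ((s - 1) * ((p + 1) * s - 2)) := by
  have e : (p + 1) ^ 2 * Lpoly p s₀ =
      (p + 1) ^ 2 * s₀ ^ 4 - 32 * p * ((s₀ - 1) * ((p + 1) * s₀ - 2)) := by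
    unfold Lpoly
    field_simp
    ring
  rw [h0, mul_zero] at e
  have h1 : s + s₀ ≤ s * s₀ := by nlinarith
  have h2 : s ^ 2 * (s₀ - 1) ≤ s₀ ^ 2 * (s - 1) := by nlinarith
  have h3 : s ^ 2 * ((p + 1) * s₀ - 2) < s₀ ^ 2 * ((p + 1) * s - 2) := by
    have : 2 * (s + s₀) < (p + 1) * (s * s₀) := by nlinarith
    nlinarith
  have h4 : 0 < s₀ - 1 := by linarith
  have h5 : 0 < (p + 1) * s₀ - 2 := by nlinarith
  have h6 : 0 < s - 1 := by linarith
  have h7 : s ^ 4 * ((s₀ - 1) * ((p + 1) * s₀ - 2)) < s₀ ^ 4 * ((s - 1) * ((p + 1) * s - 2)) := by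
    have hs0 : 0 < s := by linarith
    have hs₀0 : 0 < s₀ := hs0.trans hss₀
    have := mul_lt_mul' h2 h3 (by positivity) (by positivity)
    linarith
  have h8 := mul_lt_mul_of_pos_left h7 (by positivity : 0 < (p + 1) ^ 2)
  have h9 : (p + 1) ^ 2 * s₀ ^ 4 = 32 * p * ((s₀ - 1) * ((p + 1) * s₀ - 2)) := by linarith
  have h10 : (p + 1) ^ 2 * (s₀ ^ 4 * ((s - 1) * ((p + 1) * s - 2))) =
      32 * p * ((s - 1) * ((p + 1) * s - 2)) * ((s₀ - 1) * ((p + 1) * s₀ - 2)) := by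
    rw [← mul_assoc, h9]
    ring
  rw [h10, ← mul_assoc] at h8
  exact lt_of_mul_lt_mul_right h8 (by positivity)

/-- Two coupled reverse inequalities can be absorbed when the product of their constants is
small enough. -/
lemma exists_absorption_const {a c₁ c₂ : ℝ} (ha : 0 < a) (hc₁ : 0 < c₁) (hc₂ : 0 < c₂)
    (h : c₁ * c₂ < a ^ 2) (s : ℝ) :
    ∃ C κ : ℝ, 0 < C ∧ 0 < κ ∧ ∀ I₁ I₂ J₁ J₂ E₁ E₂ : ℝ, 0 ≤ I₁ → 0 ≤ I₂ → 0 ≤ J₁ → 0 ≤ E₁ →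
      0 ≤ E₂ → a * I₁ ≤ c₁ * J₁ + E₁ → a * I₂ ≤ c₂ * J₂ + E₂ →
      κ ^ (1 - s) * J₁ + κ⁻¹ * J₂ ≤ κ ^ (-s) * I₁ + I₂ → J₂ ≤ C * (E₁ + E₂) := by
  have hlt : c₁ / a < a / c₂ := by
    rw [div_lt_div_iff₀ ha hc₂]
    linarith
  obtain ⟨κ, hκ₁, hκ₂⟩ := exists_between hlt
  have hκ : 0 < κ := (by positivity : 0 < c₁ / a).trans hκ₁
  set b := κ ^ (-s) with hb
  have hb0 : 0 < b := rpow_pos_of_pos hκ _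
  have hbs : κ ^ (1 - s) = κ * b := by
    rw [sub_eq_add_neg, rpow_add hκ, rpow_one]
  set A₁ := b * (κ * a / c₁ - 1) with hA₁
  set A₂ := a / (κ * c₂) - 1 with hA₂
  have hA₁0 : 0 < A₁ := by
    refine mul_pos hb0 (sub_pos.2 ?_)
    rw [lt_div_iff₀ hc₁]
    rw [div_lt_iff₀ ha] at hκ₁
    linarith
  have hA₂0 : 0 < A₂ := by
    refine sub_pos.2 ?_
    rw [lt_div_iff₀ (by positivity)]
    rw [lt_div_iff₀ hc₂] at hκ₂
    linarith
  refine ⟨κ * (b / A₁ + 1 / A₂) * (κ * b / c₁ + 1 / (κ * c₂)), κ, by positivity, hκ, ?_⟩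
  intro I₁ I₂ J₁ J₂ E₁ E₂ hI₁ hI₂ hJ₁ hE₁ hE₂ h1 h2 h3
  rw [hbs] at h3
  have h4 : κ * b * ((a * I₁ - E₁) / c₁) ≤ κ * b * J₁ := by
    refine mul_le_mul_of_nonneg_left ?_ (by positivity)
    rw [div_le_iff₀ hc₁]
    linarith
  have h5 : κ⁻¹ * ((a * I₂ - E₂) / c₂) ≤ κ⁻¹ * J₂ := by
    refine mul_le_mul_of_nonneg_left ?_ (by positivity)
    rw [div_le_iff₀ hc₂]
    linarith
  set T := κ * b / c₁ * E₁ + 1 / (κ * c₂) * E₂ with hT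
  have h6 : A₁ * I₁ + A₂ * I₂ ≤ T := by
    have e1 : κ * b * ((a * I₁ - E₁) / c₁) = A₁ * I₁ + b * I₁ - κ * b / c₁ * E₁ := by
      rw [hA₁]
      field_simp
      ring
    have e2 : κ⁻¹ * ((a * I₂ - E₂) / c₂) = A₂ * I₂ + I₂ - 1 / (κ * c₂) * E₂ := by
      rw [hA₂]
      field_simp
      ring
    linarith
  have h7 : I₁ ≤ T / A₁ := by
    rw [le_div_iff₀ hA₁0]
    nlinarith [mul_nonneg hA₂0.le hI₂]
  have h8 : I₂ ≤ T / A₂ := by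
    rw [le_div_iff₀ hA₂0]
    nlinarith [mul_nonneg hA₁0.le hI₁]
  have h9 : T ≤ (κ * b / c₁ + 1 / (κ * c₂)) * (E₁ + E₂) := by
    have := mul_nonneg (by positivity : 0 ≤ κ * b / c₁) hE₂
    have := mul_nonneg (by positivity : 0 ≤ 1 / (κ * c₂)) hE₁
    rw [hT]
    linarith
  have h10 : κ⁻¹ * J₂ ≤ b * I₁ + I₂ := by
    have : 0 ≤ κ * b * J₁ := by positivity
    linarith
  rw [inv_mul_le_iff₀ hκ] at h10
  calc J₂ ≤ κ * (b * I₁ + I₂) := h10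
    _ ≤ κ * (b * (T / A₁) + T / A₂) := by gcongr
    _ = κ * (b / A₁ + 1 / A₂) * T := by ring
    _ ≤ κ * (b / A₁ + 1 / A₂) * ((κ * b / c₁ + 1 / (κ * c₂)) * (E₁ + E₂)) := by gcongr
    _ = _ := by ring

lemma rpow_sub_one_mul_add_le {y v s : ℝ} (hy : 0 < y) (hv : 0 < v) (hs : 1 ≤ s) :
    y ^ (s - 1) * v + y * v ^ (s - 1) ≤ y ^ s + v ^ s := by
  have e : ∀ t : ℝ, 0 < t → t ^ s = t ^ (s - 1) * t := fun t ht => by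
    rw [← rpow_add_one ht.ne', sub_add_cancel]
  rw [e y hy, e v hv]
  have hs' : 0 ≤ s - 1 := by linarith
  rcases le_total y v with h | h
  · have := rpow_le_rpow hy.le h hs'
    nlinarith
  · have := rpow_le_rpow hv.le h hs'
    nlinarith

end Exponents

/-- Key iteration estimate (Lemma 3.1): for `2 ≤ s < s₀` there is `C = C(N,p,s)` such that
every classical stable solution `u` of `Δ²u = u^p`, `u > 0` in `ℝ^N`, with `v = -Δu`,
satisfies `∫_{B_{2^k R}} u^p v^{s-1} ≤ (C/R²) ∫_{B_{2^{k+1} R}} v^s` for all `R > 0`, `k ∈ ℕ`. -/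
theorem iteration_estimate
    (N : ℕ) (hN : 5 ≤ N) (p : ℝ) (hp : 1 < p) (s₀ : ℝ)
    (hs₀gt : 2 * t0 p < s₀) (hs₀root : Lpoly p s₀ = 0)
    (hs₀uniq : ∀ s : ℝ, 2 * t0 p < s → Lpoly p s = 0 → s = s₀)
    (s : ℝ) (hs2 : 2 ≤ s) (hss₀ : s < s₀) :
    ∃ C : ℝ, 0 < C ∧
      ∀ u : EuclideanSpace ℝ (Fin N) → ℝ, ContDiff ℝ 4 u →
        (∀ x, 0 < u x) → (∀ x, lap (lap u) x = u x ^ p) →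
        (∀ φ : EuclideanSpace ℝ (Fin N) → ℝ, ContDiff ℝ (⊤ : ℕ∞) φ →
          HasCompactSupport φ →
          p * ∫ x, u x ^ (p - 1) * φ x ^ 2 ≤ ∫ x, (lap φ x) ^ 2) →
        ∀ R : ℝ, 0 < R → ∀ k : ℕ,
          ∫ x in Metric.ball (0 : EuclideanSpace ℝ (Fin N)) (2 ^ k * R),
              u x ^ p * (-(lap u x)) ^ (s - 1)
            ≤ C / R ^ 2 *
              ∫ x in Metric.ball (0 : EuclideanSpace ℝ (Fin N)) (2 ^ (k + 1) * R),
                (-(lap u x)) ^ s := by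
  obtain ⟨C₀, hC₀, hcut⟩ := exists_cutoff N
  have hp0 : 0 < p := by linarith
  set r : ℝ := (p + 1) / 2 * s with hr
  have hr1 : 1 < r := by rw [hr]; nlinarith
  have hs1 : 1 < s := by linarith
  have ha : 0 < √p := Real.sqrt_pos.2 hp0
  have hprod : r ^ 2 / (4 * (r - 1)) * (s ^ 2 / (4 * (s - 1))) < √p ^ 2 := by
    rw [Real.sq_sqrt hp0.le, div_mul_div_comm, div_lt_iff₀
      (mul_pos (by linarith) (by linarith))]
    have := Lpoly_neg hp hs2 hss₀ hs₀root
    rw [hr]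
    nlinarith
  obtain ⟨C₁, κ, hC₁, hκ, habs⟩ := exists_absorption_const ha
    (by have : 0 < r - 1 := by linarith
        positivity : 0 < r ^ 2 / (4 * (r - 1)))
    (by have : 0 < s - 1 := by linarith
        positivity : 0 < s ^ 2 / (4 * (s - 1))) hprod s
  set c := √(2 / (p + 1)) with hc
  have hc0 : 0 < c := Real.sqrt_pos.2 (by positivity)
  set A := (3 + |(r - 2) / (r - 1)|) * (c⁻¹) ^ s + (3 + |(s - 2) / (s - 1)|) with hA
  refine ⟨C₁ * A * C₀, by positivity, fun u hu hu0 hpde hstab R hR k => ?_⟩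
  have hu2 : ContDiff ℝ 2 u := hu.of_le (by norm_num)
  have hw2 : ContDiff ℝ 2 (lap u) := contDiff_lap hu (by norm_num)
  have hVc : Continuous fun x => p * u x ^ (p - 1) :=
    continuous_const.mul (hu2.rpow_of_pos hu0 _).continuous
  have hstab' : ∀ φ : EuclideanSpace ℝ (Fin N) → ℝ, ContDiff ℝ (⊤ : ℕ∞) φ →
      HasCompactSupport φ → ∫ x, p * u x ^ (p - 1) * φ x ^ 2 ≤ ∫ x, lap φ x ^ 2 := by
    intro φ h1 h2
    simp_rw [mul_assoc]
    rw [integral_const_mul]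
    exact hstab φ h1 h2
  have hcv := mul_rpow_le_neg_lap (by omega) hp hu hu0 hpde
    fun φ h1 h2 => stability_of_contDiff_two hVc hstab' h1 h2
  rw [← hc] at hcv
  set v : EuclideanSpace ℝ (Fin N) → ℝ := fun x => -lap u x with hv
  have hv2 : ContDiff ℝ 2 v := hw2.neg
  have hv0 : ∀ x, 0 < v x := fun x =>
    (mul_pos hc0 (rpow_pos_of_pos (hu0 x) _)).trans_le (hcv x)
  have hlapv : ∀ x, -lap v x = u x ^ p := fun x => by
    rw [hv, lap_neg hw2, neg_neg, hpde]
  set W : EuclideanSpace ℝ (Fin N) → ℝ := fun x => √p * u x ^ ((p - 1) / 2) with hW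
  have hWc : Continuous W := continuous_const.mul (hu2.rpow_of_pos hu0 _).continuous
  have hform : ∀ φ : EuclideanSpace ℝ (Fin N) → ℝ, ContDiff ℝ 2 φ → HasCompactSupport φ →
      ∫ x, W x * φ x ^ 2 ≤ ∫ x, -(φ x * lap φ x) := fun φ h1 h2 =>
    form_bound_of_stability hWc (fun x => mul_pos ha (rpow_pos_of_pos (hu0 x) _)) hVc
      (fun x => by
        simp only [hW]
        rw [mul_pow, Real.sq_sqrt hp0.le, ← rpow_natCast (u x ^ _), ← rpow_mul (hu0 x).le]
        norm_num) hstab' h1 h2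
  set ρ := 2 ^ k * R with hρ
  have hρ0 : 0 < ρ := by positivity
  have hρR : R ≤ ρ := le_mul_of_one_le_left hR.le (one_le_pow₀ (by norm_num))
  obtain ⟨η, hη, hηc, hη0, hη1, hηR, hη2, hg, hl⟩ := hcut ρ hρ0
  have hη' : ContDiff ℝ 2 η := contDiff_infty.1 hη 2
  set K := Metric.closedBall (0 : EuclideanSpace ℝ (Fin N)) (2 * ρ) with hK
  have hKc : IsCompact K := isCompact_closedBall _ _
  have hz : ∀ y ∉ K, η y = 0 := fun y hy => hη2 y (by
    have : 2 * ρ < ‖y‖ := by simpa [K] using hy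
    exact this.le)
  have hts : tsupport η ⊆ K := closure_minimal (fun y hy => by
    by_contra h
    exact hy (hz y h)) hKc.isClosed
  have k1 := integral_mul_rpow_le hform hu2 hu0 hr1 hη' hηc hη0 hη1 hg hl hKc hts
  have k2 := integral_mul_rpow_le hform hv2 hv0 hs1 hη' hηc hη0 hη1 hg hl hKc hts
  have hint : ∀ F : EuclideanSpace ℝ (Fin N) → ℝ, Continuous F →
      Integrable fun x => F x * η x ^ 2 := fun F hF =>
    (hF.mul (hη'.continuous.pow 2)).integrable_of_eq_zero hKc fun x hx => by simp [hz x hx]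
  have huc : ∀ t : ℝ, Continuous fun x => u x ^ t := fun t => (hu2.rpow_of_pos hu0 t).continuous
  have hvc : ∀ t : ℝ, Continuous fun x => v x ^ t := fun t => (hv2.rpow_of_pos hv0 t).continuous
  have iI₁ := hint _ ((huc ((p - 1) / 2)).mul (huc r))
  have iI₂ := hint _ ((huc ((p - 1) / 2)).mul (hvc s))
  have iJ₁ := hint _ ((huc (r - 1)).mul hv2.continuous)
  have iJ₂ := hint _ ((huc p).mul (hvc (s - 1)))
  simp only [Pi.mul_apply] at iI₁ iI₂ iJ₁ iJ₂
  have iK : IntegrableOn (fun x => v x ^ s) K := (hvc s).continuousOn.integrableOn_compact hKc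
  have hE : ∫ x in K, u x ^ r ≤ (c⁻¹) ^ s * ∫ x in K, v x ^ s := by
    rw [← integral_const_mul]
    refine setIntegral_mono ((huc r).continuousOn.integrableOn_compact hKc) (iK.const_mul _)
      fun x => ?_
    rw [hr, rpow_mul (hu0 x).le, ← mul_rpow (by positivity) (hv0 x).le]
    refine rpow_le_rpow (rpow_nonneg (hu0 x).le _) ?_ (by linarith)
    rw [← div_eq_inv_mul, le_div_iff₀ hc0, mul_comm]
    exact hcv x
  have hV0 : 0 ≤ ∫ x in K, v x ^ s := integral_nonneg fun x => rpow_nonneg (hv0 x).le s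
  have hU0 : 0 ≤ ∫ x in K, u x ^ r := integral_nonneg fun x => rpow_nonneg (hu0 x).le r
  have hyoung : κ ^ (1 - s) * (∫ x, u x ^ (r - 1) * v x * η x ^ 2) +
      κ⁻¹ * (∫ x, u x ^ p * v x ^ (s - 1) * η x ^ 2) ≤
      κ ^ (-s) * (∫ x, u x ^ ((p - 1) / 2) * u x ^ r * η x ^ 2) +
        ∫ x, u x ^ ((p - 1) / 2) * v x ^ s * η x ^ 2 := by
    rw [← integral_const_mul, ← integral_const_mul, ← integral_const_mul,
      ← integral_add (iJ₁.const_mul _) (iJ₂.const_mul _), ← integral_add (iI₁.const_mul _) iI₂]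
    refine integral_mono ((iJ₁.const_mul _).add (iJ₂.const_mul _))
      ((iI₁.const_mul _).add iI₂) fun x => ?_
    set X := u x ^ ((p + 1) / 2) with hX
    have hX0 : 0 < X := rpow_pos_of_pos (hu0 x) _
    have e1 : u x ^ (r - 1) = u x ^ ((p - 1) / 2) * X ^ (s - 1) := by
      rw [hX, ← rpow_mul (hu0 x).le, ← rpow_add (hu0 x), hr]
      ring_nf
    have e2 : u x ^ r = X ^ s := by rw [hX, ← rpow_mul (hu0 x).le]
    have e3 : u x ^ p = u x ^ ((p - 1) / 2) * X := by
      rw [hX, ← rpow_add (hu0 x)]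
      ring_nf
    have hy := rpow_sub_one_mul_add_le (mul_pos (inv_pos.2 hκ) hX0) (hv0 x) hs1.le
    rw [mul_rpow (inv_pos.2 hκ).le hX0.le, mul_rpow (inv_pos.2 hκ).le hX0.le,
      inv_rpow hκ.le, inv_rpow hκ.le, ← rpow_neg hκ.le, ← rpow_neg hκ.le, neg_sub] at hy
    have := mul_le_mul_of_nonneg_left hy
      (mul_nonneg (rpow_nonneg (hu0 x).le ((p - 1) / 2)) (sq_nonneg (η x)))
    show κ ^ (1 - s) * (u x ^ (r - 1) * v x * η x ^ 2) +
      κ⁻¹ * (u x ^ p * v x ^ (s - 1) * η x ^ 2) ≤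
      κ ^ (-s) * (u x ^ ((p - 1) / 2) * u x ^ r * η x ^ 2) +
        u x ^ ((p - 1) / 2) * v x ^ s * η x ^ 2
    rw [e1, e2, e3]
    linarith
  have eW : ∀ F : EuclideanSpace ℝ (Fin N) → ℝ, ∫ x, W x * (F x * η x ^ 2) =
      √p * ∫ x, u x ^ ((p - 1) / 2) * F x * η x ^ 2 := fun F => by
    rw [← integral_const_mul]
    congr 1
    ext x
    simp only [hW]
    ring
  rw [eW fun x => u x ^ r] at k1
  rw [eW fun x => v x ^ s] at k2
  simp_rw [hlapv, mul_comm (v _ ^ (s - 1))] at k2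
  have hD : 0 ≤ C₀ / ρ ^ 2 := by positivity
  have hJ₂ := habs _ _ _ _ _ _
    (integral_nonneg fun x => mul_nonneg (mul_nonneg (rpow_nonneg (hu0 x).le _)
      (rpow_nonneg (hu0 x).le _)) (sq_nonneg _))
    (integral_nonneg fun x => mul_nonneg (mul_nonneg (rpow_nonneg (hu0 x).le _)
      (rpow_nonneg (hv0 x).le _)) (sq_nonneg _))
    (integral_nonneg fun x => mul_nonneg (mul_nonneg (rpow_nonneg (hu0 x).le _)
      (hv0 x).le) (sq_nonneg _))
    (mul_nonneg (mul_nonneg (by positivity) hD) hU0)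
    (mul_nonneg (mul_nonneg (by positivity) hD) hV0) k1 k2 hyoung
  have hball : ∫ x in Metric.ball (0 : EuclideanSpace ℝ (Fin N)) (2 ^ (k + 1) * R), v x ^ s =
      ∫ x in K, v x ^ s := by
    rw [hK, hρ, ← mul_assoc, ← pow_succ']
    refine setIntegral_congr_set ?_
    rw [← Metric.ball_union_sphere]
    exact (union_ae_eq_left_of_ae_eq_empty (ae_eq_empty.2
      (Measure.addHaar_sphere_of_ne_zero volume 0 (by positivity)))).symm
  have hlhs : ∫ x in Metric.ball (0 : EuclideanSpace ℝ (Fin N)) ρ, u x ^ p * v x ^ (s - 1) ≤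
      ∫ x, u x ^ p * v x ^ (s - 1) * η x ^ 2 := by
    rw [← integral_indicator Metric.isOpen_ball.measurableSet]
    refine integral_mono ?_ iJ₂ fun x => ?_
    · exact ((((huc p).mul (hvc (s - 1))).continuousOn.integrableOn_compact
        (isCompact_closedBall (0 : EuclideanSpace ℝ (Fin N)) ρ)).mono_set
          Metric.ball_subset_closedBall).integrable_indicator Metric.isOpen_ball.measurableSet
    · show _ ≤ u x ^ p * v x ^ (s - 1) * η x ^ 2
      by_cases hx : x ∈ Metric.ball (0 : EuclideanSpace ℝ (Fin N)) ρ
      · rw [Set.indicator_of_mem hx, hηR x (by simpa using (Metric.mem_ball.1 hx).le)]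
        simp
      · rw [Set.indicator_of_notMem hx]
        exact mul_nonneg (mul_nonneg (rpow_nonneg (hu0 x).le _) (rpow_nonneg (hv0 x).le _))
          (sq_nonneg _)
  rw [hball]
  refine hlhs.trans (hJ₂.trans ?_)
  have h1 : (3 + |(r - 2) / (r - 1)|) * (C₀ / ρ ^ 2) * (∫ x in K, u x ^ r) +
      (3 + |(s - 2) / (s - 1)|) * (C₀ / ρ ^ 2) * (∫ x in K, v x ^ s) ≤
      A * (C₀ / ρ ^ 2) * ∫ x in K, v x ^ s := by
    have := mul_le_mul_of_nonneg_left hE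
      (mul_nonneg (by positivity : 0 ≤ 3 + |(r - 2) / (r - 1)|) hD)
    rw [hA]
    linarith
  calc _ ≤ C₁ * (A * (C₀ / ρ ^ 2) * ∫ x in K, v x ^ s) := by gcongr
    _ ≤ C₁ * (A * (C₀ / R ^ 2) * ∫ x in K, v x ^ s) := by gcongr
    _ = _ := by ring
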